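/- Let π ∝ exp(−V) on ℝ^d (d ≥ 2), where V is C² and α-strongly convex for some α > 0 (i.e., ∇²V ⪰ α I), and V satisfies the growth condition. Then the problem of minimizing KL(μ ‖ π) over μ ∈ C_star has a unique minimizer, and it is of the form π⋆(dz) = p⋆(dz₁) q⋆(dz_{−1} ∣ z₁) where p⋆(dz₁) ∝ exp(−h_val(z₁)) π₁(dz₁) with h_val(z₁) := inf over ν ∈ P(ℝ)^{⊗(d−1)} of KL(ν ‖ π_{−1}(· ∣ z₁)), and where, for π₁-almost every z₁, q⋆(· ∣ z₁) ∈ P(ℝ)^{⊗(d−1)} is the unique minimizer attaining h_val(z₁). -/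

import Mathlib

open MeasureTheory ProbabilityTheory
open scoped ENNReal ProbabilityTheory

open Classical in
/-- Kullback–Leibler divergence: `∫ log (dμ/dπ) dμ` if `μ ≪ π` (and the integral is
well-defined), and `+∞` otherwise. -/
noncomputable def KL {E : Type*} [MeasurableSpace E] (μ π : Measure E) : ℝ≥0∞ :=
  if μ ≪ π ∧ Integrable (fun z => Real.log (μ.rnDeriv π z).toReal) μ then
    ENNReal.ofReal (∫ z, Real.log (μ.rnDeriv π z).toReal ∂μ)
  else ⊤

/-- The star-structured measure on `ℝ × ℝ^k` with root marginal `μ₁` and leaf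
conditional kernels `κ j`, i.e. `μ₁(dz₁) ∏_j κ_j(dz_j ∣ z₁)`. -/
noncomputable def starMeasure {k : ℕ} (μ₁ : Measure ℝ) (κ : Fin k → Kernel ℝ ℝ) :
    Measure (ℝ × (Fin k → ℝ)) :=
  μ₁.bind fun z₁ => (Measure.dirac z₁).prod (Measure.pi fun j => κ j z₁)

/-- `μ ∈ C_star`: the leaf coordinates are conditionally independent given the root. -/
def IsStar {k : ℕ} (μ : Measure (ℝ × (Fin k → ℝ))) : Prop :=
  IsProbabilityMeasure μ ∧
    ∃ (μ₁ : Measure ℝ) (κ : Fin k → Kernel ℝ ℝ),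
      IsProbabilityMeasure μ₁ ∧ (∀ j, IsMarkovKernel (κ j)) ∧ μ = starMeasure μ₁ κ

/-- `ν ∈ P(ℝ)^{⊗ k}`: product probability measures on `ℝ^k`. -/
def IsProductProb {k : ℕ} (ν : Measure (Fin k → ℝ)) : Prop :=
  ∃ m : Fin k → Measure ℝ, (∀ j, IsProbabilityMeasure (m j)) ∧ ν = Measure.pi m

/-- The value of the inner mean-field variational problem with target `τ`. -/
noncomputable def hval {k : ℕ} (τ : Measure (Fin k → ℝ)) : ℝ≥0∞ :=
  ⨅ (ν : Measure (Fin k → ℝ)) (_ : IsProductProb ν), KL ν τ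

/-- The probability measure with density proportional to `exp (-V)` (w.r.t. Lebesgue). -/
noncomputable def gibbs {E : Type*} [MeasureSpace E] (V : E → ℝ) : Measure E :=
  ((volume.withDensity fun z => ENNReal.ofReal (Real.exp (-V z))) Set.univ)⁻¹ •
    (volume.withDensity fun z => ENNReal.ofReal (Real.exp (-V z)))

/-- The squared Euclidean norm on `ℝ × ℝ^k`. -/
def sqNorm {k : ℕ} (v : ℝ × (Fin k → ℝ)) : ℝ := v.1 ^ 2 + ∑ i, v.2 i ^ 2

/-- Growth condition: for every `c₂ > 0` there is `c₁ > 0` with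
`|V z| ≤ c₁ exp (c₂ ‖z‖²)`. -/
def GrowthCond {k : ℕ} (V : ℝ × (Fin k → ℝ) → ℝ) : Prop :=
  ∀ c₂ : ℝ, 0 < c₂ → ∃ c₁ : ℝ, 0 < c₁ ∧ ∀ z, |V z| ≤ c₁ * Real.exp (c₂ * sqNorm z)

/-- `α`-strong convexity (w.r.t. the Euclidean structure). -/
def StrongConvexWith {k : ℕ} (α : ℝ) (V : ℝ × (Fin k → ℝ) → ℝ) : Prop :=
  ∀ x y : ℝ × (Fin k → ℝ), ∀ t : ℝ, t ∈ Set.Icc (0:ℝ) 1 →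
    V ((1 - t) • x + t • y) ≤
      (1 - t) * V x + t * V y - α / 2 * t * (1 - t) * sqNorm (x - y)

section

open InformationTheory Filter Topology
open scoped BoundedContinuousFunction

theorem KL_eq_klDiv {E : Type*} [MeasurableSpace E] (μ ν : Measure E)
    [IsProbabilityMeasure μ] [IsProbabilityMeasure ν] : KL μ ν = klDiv μ ν := by
  rw [klDiv_def, KL]
  simp only [llr_def, probReal_univ, add_sub_cancel_right]
  congr

theorem toReal_klDiv_eq_integral_llr {E : Type*} [MeasurableSpace E] {μ ν : Measure E}
    [IsProbabilityMeasure μ] [IsProbabilityMeasure ν] (h : klDiv μ ν ≠ ⊤) :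
    (klDiv μ ν).toReal = ∫ x, llr μ ν x ∂μ :=
  toReal_klDiv_of_measure_eq (klDiv_ne_top_iff.1 h).1 (by simp)

/-- The easy half of the Donsker–Varadhan formula. -/
theorem integral_le_toReal_klDiv_add_log {E : Type*} [MeasurableSpace E] {μ ν : Measure E}
    [IsProbabilityMeasure μ] [IsProbabilityMeasure ν] (h : klDiv μ ν ≠ ⊤) {φ : E → ℝ}
    (hφ : Integrable φ μ) (hφ' : Integrable (fun x => Real.exp (φ x)) ν) :
    ∫ x, φ x ∂μ ≤ (klDiv μ ν).toReal + Real.log (∫ x, Real.exp (φ x) ∂ν) := by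
  obtain ⟨hac, hint⟩ := klDiv_ne_top_iff.1 h
  have := isProbabilityMeasure_tilted hφ'
  have h1 := integral_llr_tilted_right hac hφ hφ' hint
  have h2 := integral_llr_add_sub_measure_univ_nonneg
    (hac.trans (absolutelyContinuous_tilted hφ')) (integrable_llr_tilted_right hac hφ hint hφ')
  rw [toReal_klDiv_eq_integral_llr h]
  simp only [probReal_univ] at h2
  linarith

/-- Jensen's inequality for the exponential, with an integrability-free right-hand side. -/
theorem integral_le_log_of_lintegral_exp_le {E : Type*} [MeasurableSpace E] {P : Measure E}
    [IsProbabilityMeasure P] {ψ : E → ℝ} (hψ : Integrable ψ P) {B : ℝ}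
    (h : ∫⁻ x, ENNReal.ofReal (Real.exp (ψ x)) ∂P ≤ ENNReal.ofReal B) :
    ∫ x, ψ x ∂P ≤ Real.log B := by
  have hm : AEStronglyMeasurable (fun x => Real.exp (ψ x)) P :=
    Real.continuous_exp.comp_aestronglyMeasurable hψ.1
  have hI : Integrable (fun x => Real.exp (ψ x)) P :=
    ⟨hm, by
      rw [hasFiniteIntegral_iff_ofReal (ae_of_all _ fun x => (Real.exp_pos _).le)]
      exact h.trans_lt ENNReal.ofReal_lt_top⟩
  have hJ : Real.exp (∫ x, ψ x ∂P) ≤ ∫ x, Real.exp (ψ x) ∂P :=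
    convexOn_exp.map_integral_le Real.continuous_exp.continuousOn isClosed_univ
      (ae_of_all _ fun _ => Set.mem_univ _) hψ hI
  rw [← ofReal_integral_eq_lintegral_ofReal hI (ae_of_all _ fun x => (Real.exp_pos _).le)] at h
  have hB : 0 < B := by
    by_contra hB
    rw [ENNReal.ofReal_of_nonpos (not_lt.1 hB), nonpos_iff_eq_zero, ENNReal.ofReal_eq_zero] at h
    exact absurd (hJ.trans h) (not_le.2 (Real.exp_pos _))
  rw [ENNReal.ofReal_le_ofReal_iff hB.le] at h
  rw [Real.le_log_iff_exp_le hB]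
  exact hJ.trans h

/-- Bounded measurable functions are almost everywhere limits of uniformly bounded continuous
functions. -/
theorem exists_boundedContinuous_tendsto_ae {E : Type*} [TopologicalSpace E] [NormalSpace E]
    [MeasurableSpace E] [BorelSpace E] {ρ : Measure E} [IsFiniteMeasure ρ] [ρ.WeaklyRegular]
    {φ : E → ℝ} (hφ : Measurable φ) {M : ℝ} (hM : ∀ x, |φ x| ≤ M) :
    ∃ g : ℕ → E →ᵇ ℝ, (∀ n x, |g n x| ≤ M) ∧
      ∀ᵐ x ∂ρ, Tendsto (fun n => g n x) atTop (𝓝 (φ x)) := by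
  have hφi : MemLp φ 1 ρ :=
    MemLp.of_bound hφ.aestronglyMeasurable M (ae_of_all _ fun x => by simpa using hM x)
  have H : ∀ n : ℕ, ∃ g : E →ᵇ ℝ, eLpNorm (φ - ⇑g) 1 ρ ≤ ((n : ℝ≥0∞) + 1)⁻¹ ∧ MemLp (⇑g) 1 ρ :=
    fun n => hφi.exists_boundedContinuous_eLpNorm_sub_le ENNReal.one_ne_top (by simp)
  choose g hg hg' using H
  have hlim : Tendsto (fun n => eLpNorm (⇑(g n) - φ) 1 ρ) atTop (𝓝 0) := by
    have h0 : Tendsto (fun n : ℕ => ((n : ℝ≥0∞) + 1)⁻¹) atTop (𝓝 0) := by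
      have := (tendsto_add_atTop_iff_nat 1).2 ENNReal.tendsto_inv_nat_nhds_zero
      simpa using this
    refine tendsto_of_tendsto_of_tendsto_of_le_of_le tendsto_const_nhds h0 (fun _ => zero_le)
      fun n => ?_
    rw [eLpNorm_sub_comm]
    exact hg n
  obtain ⟨ns, -, hns⟩ := (tendstoInMeasure_of_tendsto_eLpNorm one_ne_zero
    (fun n => (hg' n).1) hφi.1 hlim).exists_seq_tendsto_ae
  have hM0 : ∀ x : E, -M ≤ M := fun x => by linarith [abs_nonneg (φ x), hM x]
  refine ⟨fun n => BoundedContinuousFunction.ofNormedAddCommGroup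
    (fun x => max (-M) (min M (g (ns n) x))) (by fun_prop) |M| fun x => ?_, fun n x => ?_, ?_⟩
  · rw [Real.norm_eq_abs]
    refine (abs_le.2 ⟨le_max_left _ _, max_le (hM0 x) (min_le_left _ _)⟩).trans (le_abs_self M)
  · exact abs_le.2 ⟨le_max_left _ _, max_le (hM0 x) (min_le_left _ _)⟩
  · filter_upwards [hns] with x hx
    have hc : Continuous fun t : ℝ => max (-M) (min M t) := by fun_prop
    have := (hc.tendsto (φ x)).comp hx
    have e : max (-M) (min M (φ x)) = φ x := by
      rw [min_eq_right (abs_le.1 (hM x)).2, max_eq_right (abs_le.1 (hM x)).1]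
    rw [e] at this
    exact this

theorem integrable_of_abs_le {E : Type*} [MeasurableSpace E] {μ : Measure E} [IsFiniteMeasure μ]
    {φ : E → ℝ} (hφ : Measurable φ) {M : ℝ} (hM : ∀ x, |φ x| ≤ M) : Integrable φ μ :=
  Integrable.of_bound hφ.aestronglyMeasurable M (ae_of_all _ fun x => by simpa using hM x)

theorem integrable_exp_of_abs_le {E : Type*} [MeasurableSpace E] {μ : Measure E}
    [IsFiniteMeasure μ] {φ : E → ℝ} (hφ : Measurable φ) {M : ℝ} (hM : ∀ x, |φ x| ≤ M) :
    Integrable (fun x => Real.exp (φ x)) μ :=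
  integrable_of_abs_le (M := Real.exp M) (by fun_prop) fun x => by
    rw [abs_of_pos (Real.exp_pos _)]
    exact Real.exp_le_exp.2 (le_of_abs_le (hM x))

/-- If the Donsker–Varadhan inequality holds for bounded continuous functions, then it holds for
bounded measurable ones. -/
theorem donskerVaradhan_extend {E : Type*} [TopologicalSpace E] [NormalSpace E]
    [MeasurableSpace E] [BorelSpace E] {μ ν : Measure E} [IsProbabilityMeasure μ]
    [IsProbabilityMeasure ν] [(μ + ν).WeaklyRegular] {C : ℝ}
    (h : ∀ φ : E →ᵇ ℝ, ∫ x, φ x ∂μ ≤ C + Real.log (∫ x, Real.exp (φ x) ∂ν))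
    {φ : E → ℝ} (hφ : Measurable φ) {M : ℝ} (hM : ∀ x, |φ x| ≤ M) :
    ∫ x, φ x ∂μ ≤ C + Real.log (∫ x, Real.exp (φ x) ∂ν) := by
  obtain ⟨g, hgM, hg⟩ := exists_boundedContinuous_tendsto_ae (ρ := μ + ν) hφ hM
  rw [ae_add_measure_iff] at hg
  have h1 : Tendsto (fun n => ∫ x, g n x ∂μ) atTop (𝓝 (∫ x, φ x ∂μ)) :=
    tendsto_integral_of_dominated_convergence (fun _ => M)
      (fun n => (g n).continuous.measurable.aestronglyMeasurable) (integrable_const _)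
      (fun n => ae_of_all _ fun x => by simpa using hgM n x) hg.1
  have h2 : Tendsto (fun n => ∫ x, Real.exp (g n x) ∂ν) atTop (𝓝 (∫ x, Real.exp (φ x) ∂ν)) := by
    refine tendsto_integral_of_dominated_convergence (fun _ => Real.exp M)
      (fun n => (Real.continuous_exp.comp (g n).continuous).measurable.aestronglyMeasurable)
      (integrable_const _)
      (fun n => ae_of_all _ fun x => ?_) ?_
    · rw [Real.norm_eq_abs, abs_of_pos (Real.exp_pos _)]
      exact Real.exp_le_exp.2 (le_of_abs_le (hgM n x))
    · filter_upwards [hg.2] with x hx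
      exact (Real.continuous_exp.tendsto _).comp hx
  have hpos : 0 < ∫ x, Real.exp (φ x) ∂ν := integral_exp_pos (integrable_exp_of_abs_le hφ hM)
  exact le_of_tendsto_of_tendsto' h1
    ((h2.log hpos.ne').const_add C) fun n => h (g n)

/-- The hard half of the Donsker–Varadhan formula. -/
theorem klDiv_le_of_forall_boundedContinuous {E : Type*} [TopologicalSpace E] [NormalSpace E]
    [MeasurableSpace E] [BorelSpace E] {μ ν : Measure E} [IsProbabilityMeasure μ]
    [IsProbabilityMeasure ν] [(μ + ν).WeaklyRegular] {C : ℝ}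
    (h : ∀ φ : E →ᵇ ℝ, ∫ x, φ x ∂μ ≤ C + Real.log (∫ x, Real.exp (φ x) ∂ν)) :
    klDiv μ ν ≤ ENNReal.ofReal C := by
  have hac : μ ≪ ν := by
    refine Measure.AbsolutelyContinuous.mk fun A hA hA0 => ?_
    have key : ∀ n : ℕ, n * μ.real A ≤ C := fun n => by
      have hb : ∀ x, |A.indicator (fun _ => (n : ℝ)) x| ≤ n := fun x => by
        by_cases hx : x ∈ A <;> simp [hx]
      have := donskerVaradhan_extend h (φ := A.indicator fun _ => (n : ℝ))
        (measurable_const.indicator hA) hb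
      rw [integral_indicator_const _ hA] at this
      have e : ∫ x, Real.exp (A.indicator (fun _ => (n : ℝ)) x) ∂ν = 1 := by
        have : (fun x => Real.exp (A.indicator (fun _ => (n : ℝ)) x)) =ᵐ[ν] fun _ => 1 := by
          have : ∀ᵐ x ∂ν, x ∉ A := measure_eq_zero_iff_ae_notMem.1 hA0
          filter_upwards [this] with x hx
          simp [hx]
        rw [integral_congr_ae this]
        simp
      rw [e, Real.log_one, add_zero, smul_eq_mul, mul_comm] at this
      exact this
    have : μ.real A ≤ 0 := by
      by_contra hpos
      push Not at hpos
      obtain ⟨n, hn⟩ := exists_nat_gt (C / μ.real A)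
      rw [div_lt_iff₀ hpos] at hn
      exact absurd (key n) (not_le.2 hn)
    have h0 : μ.real A = 0 := le_antisymm this measureReal_nonneg
    exact (measureReal_eq_zero_iff).1 h0
  set r : E → ℝ := fun x => (μ.rnDeriv ν x).toReal with hr
  have hrm : Measurable r := (Measure.measurable_rnDeriv μ ν).ennreal_toReal
  have hr0 : ∀ x, 0 ≤ r x := fun x => ENNReal.toReal_nonneg
  let c : ℕ → E → ℝ := fun n x => max (Real.exp (-n)) (min (Real.exp n) (r x))
  have hcm : ∀ n, Measurable (c n) := fun n => by fun_prop
  have hc0 : ∀ n x, 0 < c n x := fun n x => lt_max_of_lt_left (Real.exp_pos _)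
  have hcle : ∀ n x, c n x ≤ Real.exp n := fun n x =>
    max_le (Real.exp_le_exp.2 (by linarith [(Nat.cast_nonneg n : (0:ℝ) ≤ n)])) (min_le_left _ _)
  have hφb : ∀ n x, |Real.log (c n x)| ≤ n := fun n x => by
    refine abs_le.2 ⟨?_, ?_⟩
    · rw [Real.le_log_iff_exp_le (hc0 n x)]
      exact le_max_left _ _
    · rw [Real.log_le_iff_le_exp (hc0 n x)]
      exact hcle n x
  have hφm : ∀ n, Measurable fun x => Real.log (c n x) := fun n => (hcm n).log
  have hnn : ∀ n x, 0 ≤ r x * Real.log (c n x) + 1 - c n x := fun n x => by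
    have h1 : c n x * Real.log (c n x) ≤ r x * Real.log (c n x) := by
      rcases le_total (r x) 1 with h | h
      · have h2 : c n x ≤ 1 :=
          max_le (Real.exp_le_one_iff.2 (by simp)) ((min_le_right _ _).trans h)
        have h3 : r x ≤ c n x := le_max_of_le_right
          (le_min (h.trans (Real.one_le_exp (Nat.cast_nonneg n))) le_rfl)
        exact mul_le_mul_of_nonpos_right h3 (Real.log_nonpos (hc0 n x).le h2)
      · have h2 : 1 ≤ c n x :=
          le_max_of_le_right (le_min (Real.one_le_exp (Nat.cast_nonneg n)) h)
        have h3 : c n x ≤ r x :=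
          max_le ((Real.exp_le_one_iff.2 (by simp)).trans h) (min_le_right _ _)
        exact mul_le_mul_of_nonneg_right h3 (Real.log_nonneg h2)
    have h2 := klFun_nonneg (hc0 n x).le
    rw [klFun_apply] at h2
    linarith
  have hlim : ∀ x, Tendsto (fun n : ℕ => r x * Real.log (c n x) + 1 - c n x) atTop
      (𝓝 (klFun (r x))) := fun x => by
    have he : Tendsto (fun n : ℕ => Real.exp (-n)) atTop (𝓝 0) :=
      Real.tendsto_exp_neg_atTop_nhds_zero.comp tendsto_natCast_atTop_atTop
    have hc : Tendsto (fun n => c n x) atTop (𝓝 (r x)) := by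
      have h1 : Tendsto (fun n : ℕ => min (Real.exp n) (r x)) atTop (𝓝 (r x)) := by
        refine tendsto_const_nhds.congr' ?_
        filter_upwards [(Real.tendsto_exp_atTop.comp
          tendsto_natCast_atTop_atTop).eventually_ge_atTop (r x)] with n hn
        exact (min_eq_right hn).symm
      simpa [max_eq_right (hr0 x)] using he.max h1
    rw [klFun_apply]
    refine (Tendsto.add_const 1 ?_).sub hc
    rcases (hr0 x).eq_or_lt with h0 | h0
    · simp [← h0]
    · exact (hc.log h0.ne').const_mul _
  rw [klDiv_eq_lintegral_klFun_of_ac hac]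
  have hstep : ∀ n, ∫⁻ x, ENNReal.ofReal (r x * Real.log (c n x) + 1 - c n x) ∂ν
      ≤ ENNReal.ofReal C := fun n => by
    have hI1 : Integrable (fun x => Real.log (c n x)) μ := integrable_of_abs_le (hφm n) (hφb n)
    have hI2 : Integrable (fun x => r x * Real.log (c n x)) ν :=
      (integrable_rnDeriv_smul_iff hac).2 hI1
    have hI3 : Integrable (c n) ν := integrable_of_abs_le (hcm n) (M := Real.exp n) fun x => by
      rw [abs_of_pos (hc0 n x)]
      exact hcle n x
    have hI4 : Integrable (fun x => r x * Real.log (c n x) + 1 - c n x) ν :=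
      (hI2.add (integrable_const 1)).sub hI3
    rw [← ofReal_integral_eq_lintegral_ofReal hI4 (ae_of_all _ (hnn n))]
    refine ENNReal.ofReal_le_ofReal ?_
    have e1 : ∫ x, r x * Real.log (c n x) ∂ν = ∫ x, Real.log (c n x) ∂μ :=
      integral_rnDeriv_smul hac
    have e2 := donskerVaradhan_extend h (hφm n) (hφb n)
    simp only [Real.exp_log (hc0 n _)] at e2
    have e3 : 0 < ∫ x, c n x ∂ν := by
      have := integral_exp_pos (μ := ν) (f := fun x => Real.log (c n x))
        (by simpa only [Real.exp_log (hc0 n _)] using hI3)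
      simpa only [Real.exp_log (hc0 n _)] using this
    have e4 := Real.log_le_sub_one_of_pos e3
    have e5 : ∫ x, (r x * Real.log (c n x) + 1 - c n x) ∂ν
        = ∫ x, Real.log (c n x) ∂μ + 1 - ∫ x, c n x ∂ν := by
      rw [← e1, integral_sub (f := fun x => r x * Real.log (c n x) + 1)
        (hI2.add (integrable_const 1)) hI3, integral_add hI2 (integrable_const 1)]
      simp
    linarith
  calc ∫⁻ x, ENNReal.ofReal (klFun (r x)) ∂ν
      = ∫⁻ x, liminf (fun n => ENNReal.ofReal (r x * Real.log (c n x) + 1 - c n x)) atTop ∂ν := by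
        refine lintegral_congr fun x => ?_
        exact ((ENNReal.tendsto_ofReal (hlim x)).liminf_eq).symm
    _ ≤ liminf (fun n => ∫⁻ x, ENNReal.ofReal (r x * Real.log (c n x) + 1 - c n x) ∂ν) atTop :=
        lintegral_liminf_le fun n => by fun_prop
    _ ≤ ENNReal.ofReal C := by
        refine (liminf_le_liminf (Eventually.of_forall hstep)).trans ?_
        simp

/-- Lower semicontinuity of the Kullback–Leibler divergence in its first argument, along laws of
almost surely convergent random variables. -/
theorem klDiv_map_le_of_tendsto_ae {Ω E : Type*} [MeasurableSpace Ω] {P : Measure Ω}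
    [IsProbabilityMeasure P] [TopologicalSpace E] [NormalSpace E]
    [MeasurableSpace E] [BorelSpace E] {X : ℕ → Ω → E} {Y : Ω → E}
    (hX : ∀ n, Measurable (X n)) (hY : Measurable Y) {ν : Measure E} [IsProbabilityMeasure ν]
    [(P.map Y + ν).WeaklyRegular]
    (hlim : ∀ᵐ ω ∂P, Tendsto (fun n => X n ω) atTop (𝓝 (Y ω)))
    {c : ℕ → ℝ} {C : ℝ} (hc : Tendsto c atTop (𝓝 C)) (hc0 : ∀ n, 0 ≤ c n)
    (hle : ∀ n, klDiv (P.map (X n)) ν ≤ ENNReal.ofReal (c n)) :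
    klDiv (P.map Y) ν ≤ ENNReal.ofReal C := by
  have := Measure.isProbabilityMeasure_map (μ := P) hY.aemeasurable
  have hp := fun n => Measure.isProbabilityMeasure_map (μ := P) (hX n).aemeasurable
  refine klDiv_le_of_forall_boundedContinuous fun φ => ?_
  have hb : ∀ x, |φ x| ≤ ‖φ‖ := fun x => φ.norm_coe_le_norm x
  have hφ := φ.continuous.measurable
  have h1 : ∀ n, ∫ ω, φ (X n ω) ∂P ≤ c n + Real.log (∫ x, Real.exp (φ x) ∂ν) := fun n => by
    have hf : klDiv (P.map (X n)) ν ≠ ⊤ := ((hle n).trans_lt ENNReal.ofReal_lt_top).ne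
    have h2 := integral_le_toReal_klDiv_add_log hf (integrable_of_abs_le hφ hb)
      (integrable_exp_of_abs_le hφ hb)
    rw [integral_map (hX n).aemeasurable hφ.aestronglyMeasurable] at h2
    have h3 : (klDiv (P.map (X n)) ν).toReal ≤ c n :=
      ENNReal.toReal_le_of_le_ofReal (hc0 n) (hle n)
    linarith
  rw [integral_map hY.aemeasurable hφ.aestronglyMeasurable]
  have h2 : Tendsto (fun n => ∫ ω, φ (X n ω) ∂P) atTop (𝓝 (∫ ω, φ (Y ω) ∂P)) := by
    refine tendsto_integral_of_dominated_convergence (fun _ => ‖φ‖)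
      (fun n => (hφ.comp (hX n)).aestronglyMeasurable) (integrable_const _)
      (fun n => ae_of_all _ fun ω => hb _) ?_
    filter_upwards [hlim] with ω hω
    exact (φ.continuous.tendsto _).comp hω
  exact le_of_tendsto_of_tendsto' h2 (hc.add_const _) h1

/-- The uniform distribution on `(0, 1)`. -/
noncomputable def unif : Measure ℝ := volume.restrict (Set.Ioo 0 1)

instance : IsProbabilityMeasure unif := ⟨by simp [unif]⟩

open Classical in
/-- The quantile function of a measure on the line, extended by `0` outside of `(0, 1)`. -/
noncomputable def quantile (m : Measure ℝ) (u : ℝ) : ℝ :=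
  if u ∈ Set.Ioo (0 : ℝ) 1 then sInf {x | u ≤ cdf m x} else 0

theorem quantile_le_iff (m : Measure ℝ) {u : ℝ} (hu : u ∈ Set.Ioo (0 : ℝ) 1) (x : ℝ) :
    quantile m u ≤ x ↔ u ≤ cdf m x := by
  have hne : ∃ y, u ≤ cdf m y :=
    ((tendsto_cdf_atTop m).eventually (lt_mem_nhds hu.2)).exists.imp fun _ h => h.le
  obtain ⟨b, hb⟩ := ((tendsto_cdf_atBot m).eventually (gt_mem_nhds hu.1)).exists
  have hbdd : BddBelow {y | u ≤ cdf m y} := ⟨b, fun y hy => by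
    by_contra hlt
    exact absurd (hy.trans (monotone_cdf m (not_le.1 hlt).le)) (not_le.2 hb)⟩
  rw [quantile, if_pos hu]
  refine ⟨fun h => ?_, fun h => csInf_le hbdd h⟩
  have hev : ∀ᶠ y in 𝓝[>] x, u ≤ cdf m y := by
    filter_upwards [self_mem_nhdsWithin] with y hy
    obtain ⟨w, hw, hwy⟩ := exists_lt_of_csInf_lt hne (lt_of_le_of_lt h hy)
    exact le_trans (show u ≤ cdf m w from hw) (monotone_cdf m hwy.le)
  exact ge_of_tendsto (((cdf m).right_continuous x).mono_left
    (nhdsWithin_mono x Set.Ioi_subset_Ici_self)) hev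

theorem monotoneOn_quantile (m : Measure ℝ) : MonotoneOn (quantile m) (Set.Ioo 0 1) :=
  fun _ hu _ hv huv => (quantile_le_iff m hu _).2 (huv.trans ((quantile_le_iff m hv _).1 le_rfl))

theorem measurable_quantile (m : Measure ℝ) : Measurable (quantile m) := by
  refine measurable_of_Iic fun x => ?_
  have : quantile m ⁻¹' Set.Iic x = (Set.Ioo 0 1 ∩ Set.Iic (cdf m x)) ∪
      ((Set.Ioo 0 1)ᶜ ∩ {_u | (0 : ℝ) ≤ x}) := by
    ext u
    by_cases hu : u ∈ Set.Ioo (0 : ℝ) 1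
    · simp only [Set.mem_preimage, Set.mem_Iic, quantile_le_iff m hu, Set.mem_union,
        Set.mem_inter_iff, Set.mem_compl_iff, hu, true_and, not_true, false_and, or_false]
    · have : quantile m u = 0 := if_neg hu
      simp only [Set.mem_preimage, Set.mem_Iic, this, Set.mem_union,
        Set.mem_inter_iff, Set.mem_compl_iff, hu, false_and, not_false_iff, true_and, false_or,
        Set.mem_ofPred_eq]
  rw [this]
  exact (measurableSet_Ioo.inter measurableSet_Iic).union
    (measurableSet_Ioo.compl.inter (MeasurableSet.const _))

theorem map_quantile (m : Measure ℝ) [IsProbabilityMeasure m] : unif.map (quantile m) = m := by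
  have := Measure.isProbabilityMeasure_map (μ := unif) (measurable_quantile m).aemeasurable
  refine Measure.ext_of_Iic _ _ fun x => ?_
  rw [Measure.map_apply (measurable_quantile m) measurableSet_Iic, unif,
    Measure.restrict_apply (measurable_quantile m measurableSet_Iic), ← ofReal_cdf m x]
  have h0 := cdf_nonneg m x
  have h1 := cdf_le_one m x
  have : quantile m ⁻¹' Set.Iic x ∩ Set.Ioo 0 1 = Set.Ioc 0 (cdf m x) ∩ Set.Iio 1 := by
    ext u
    constructor
    · rintro ⟨h, hu⟩
      exact ⟨⟨hu.1, (quantile_le_iff m hu x).1 h⟩, hu.2⟩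
    · rintro ⟨h, hu⟩
      exact ⟨(quantile_le_iff m ⟨h.1, hu⟩ x).2 h.2, h.1, hu⟩
  rw [this]
  refine le_antisymm ((measure_mono Set.inter_subset_left).trans (by simp)) ?_
  have h2 : Set.Ioo 0 (cdf m x) ⊆ Set.Ioc 0 (cdf m x) ∩ Set.Iio 1 :=
    fun u hu => ⟨⟨hu.1, hu.2.le⟩, hu.2.trans_le h1⟩
  exact le_trans (by simp) (measure_mono h2)

theorem ae_unif_of_ae {p : ℝ → Prop} (h : ∀ᵐ u, p u) : ∀ᵐ u ∂unif, p u :=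
  ae_restrict_of_ae h

theorem ae_unif_mem : ∀ᵐ u ∂unif, u ∈ Set.Ioo (0 : ℝ) 1 := ae_restrict_mem measurableSet_Ioo

theorem cdf_quantile {m : Measure ℝ} [IsProbabilityMeasure m] (hm : m ≪ volume) {u : ℝ}
    (hu : u ∈ Set.Ioo (0 : ℝ) 1) : cdf m (quantile m u) = u := by
  have hge : u ≤ cdf m (quantile m u) := (quantile_le_iff m hu _).1 le_rfl
  refine le_antisymm ?_ hge
  have hleft : Function.leftLim (cdf m) (quantile m u) ≤ u := by
    refine le_of_tendsto ((monotone_cdf m).tendsto_leftLim _) ?_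
    filter_upwards [self_mem_nhdsWithin] with y hy
    by_contra hlt
    exact absurd ((quantile_le_iff m hu y).2 (not_le.1 hlt).le) (not_le.2 hy)
  have hs : (cdf m).measure {quantile m u} = 0 := by
    rw [measure_cdf]; exact hm (measure_singleton _)
  rw [StieltjesFunction.measure_singleton, ENNReal.ofReal_eq_zero] at hs
  linarith

/-- Almost everywhere, the quantile function of an absolutely continuous law is differentiable,
with derivative the inverse of the density. -/
theorem ae_hasDerivAt_quantile {m : Measure ℝ} [IsProbabilityMeasure m] (hm : m ≪ volume) :
    ∀ᵐ u ∂unif, 0 < (m.rnDeriv volume (quantile m u)).toReal ∧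
      HasDerivAt (quantile m) (m.rnDeriv volume (quantile m u)).toReal⁻¹ u := by
  have h1 : ∀ᵐ x ∂m, 0 < (m.rnDeriv volume x).toReal ∧
      HasDerivAt (cdf m) (m.rnDeriv volume x).toReal x := by
    have h2 := (cdf m).ae_hasDerivAt
    rw [measure_cdf] at h2
    filter_upwards [hm.ae_le h2, Measure.rnDeriv_pos hm, hm.ae_le (Measure.rnDeriv_ne_top m volume)]
      with x hx hx1 hx2
    exact ⟨ENNReal.toReal_pos hx1.ne' hx2, hx⟩
  rw [← map_quantile m] at h1
  have h3 := ae_of_ae_map (measurable_quantile m).aemeasurable h1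
  rw [map_quantile m] at h3
  have h4 : ∀ᵐ u ∂unif, ContinuousAt (quantile m) u := by
    filter_upwards [ae_unif_of_ae ((monotoneOn_quantile m).ae_differentiableWithinAt_of_mem),
      ae_unif_mem] with u hu hu1
    exact (hu hu1).continuousWithinAt.continuousAt (Ioo_mem_nhds hu1.1 hu1.2)
  filter_upwards [h3, h4, ae_unif_mem] with u hu hu1 hu2
  refine ⟨hu.1, HasDerivAt.of_local_left_inverse hu1 hu.2 hu.1.ne' ?_⟩
  filter_upwards [Ioo_mem_nhds hu2.1 hu2.2] with v hv
  exact cdf_quantile hm hv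

theorem lintegral_pi_prod {k : ℕ} (μ : Fin k → Measure ℝ) [∀ i, SigmaFinite (μ i)]
    {f : Fin k → ℝ → ℝ≥0∞} (hf : ∀ i, Measurable (f i)) :
    ∫⁻ x, ∏ i, f i (x i) ∂(Measure.pi μ) = ∏ i, ∫⁻ x, f i x ∂(μ i) := by
  induction k with
  | zero => simp
  | succ n ih =>
    have hmeas : Measurable fun y : Fin n → ℝ => ∏ i : Fin n, f i.succ (y i) :=
      Finset.measurable_prod _ fun i _ => (hf _).comp (measurable_pi_apply i)
    rw [← ((measurePreserving_piFinSuccAbove μ 0).symm).lintegral_comp_emb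
      (MeasurableEquiv.measurableEmbedding _), Fin.prod_univ_succ, ← ih (fun i => μ i.succ)
      (fun i => hf i.succ), ← lintegral_prod_mul (hf 0).aemeasurable hmeas.aemeasurable]
    simp only [MeasurableEquiv.piFinSuccAbove_symm_apply, Fin.insertNthEquiv,
      Fin.prod_univ_succ, Fin.insertNth_zero, Equiv.coe_fn_mk, Fin.cons_succ,
      Fin.zero_succAbove, Fin.cons_zero]
    rfl

theorem pi_withDensity {k : ℕ} (μ : Fin k → Measure ℝ) [∀ i, SigmaFinite (μ i)]
    {f : Fin k → ℝ → ℝ≥0∞} (hf : ∀ i, Measurable (f i))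
    [∀ i, SigmaFinite ((μ i).withDensity (f i))] :
    Measure.pi (fun i => (μ i).withDensity (f i)) =
      (Measure.pi μ).withDensity fun x => ∏ i, f i (x i) := by
  refine Measure.pi_eq fun s hs => ?_
  rw [withDensity_apply _ (MeasurableSet.univ_pi hs), Measure.restrict_pi_pi,
    lintegral_pi_prod (fun i => (μ i).restrict (s i)) hf]
  exact Finset.prod_congr rfl fun i _ => (withDensity_apply _ (hs i)).symm

/-- The law of independent uniform variables. -/
noncomputable abbrev unifPi (k : ℕ) : Measure (Fin k → ℝ) := Measure.pi fun _ => unif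

theorem map_quantile_pi {k : ℕ} (m : Fin k → Measure ℝ) [∀ j, IsProbabilityMeasure (m j)] :
    (unifPi k).map (fun u j => quantile (m j) (u j)) = Measure.pi m := by
  have : ∀ j, SigmaFinite (unif.map (quantile (m j))) := fun j => by
    rw [map_quantile]; infer_instance
  rw [unifPi, Measure.pi_map_pi fun j => (measurable_quantile (m j)).aemeasurable]
  congr 1
  ext1 j
  exact map_quantile (m j)

theorem measurable_quantile_pi {k : ℕ} (m : Fin k → Measure ℝ) :
    Measurable fun (u : Fin k → ℝ) j => quantile (m j) (u j) :=
  measurable_pi_lambda _ fun j => (measurable_quantile _).comp (measurable_pi_apply j)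

theorem ae_pi_of_forall_ae {k : ℕ} {μ : Fin k → Measure ℝ} [∀ j, IsProbabilityMeasure (μ j)]
    {p : Fin k → ℝ → Prop} (h : ∀ j, ∀ᵐ x ∂(μ j), p j x) :
    ∀ᵐ x ∂(Measure.pi μ), ∀ j, p j (x j) :=
  ae_all_iff.2 fun j => (measurePreserving_eval μ j).quasiMeasurePreserving.ae (h j)

/-- The measure on `ℝ^k` with density `exp (-W)`. -/
noncomputable def expDensity {k : ℕ} (W : (Fin k → ℝ) → ℝ) : Measure (Fin k → ℝ) :=
  volume.withDensity fun y => ENNReal.ofReal (Real.exp (-W y))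

theorem pi_eq_expDensity_withDensity {k : ℕ} {W : (Fin k → ℝ) → ℝ} (hW : Measurable W)
    {m : Fin k → Measure ℝ} [∀ j, IsProbabilityMeasure (m j)] (hm : ∀ j, m j ≪ volume) :
    Measure.pi m = (expDensity W).withDensity
      fun y => ENNReal.ofReal (Real.exp (W y)) * ∏ j, (m j).rnDeriv volume (y j) := by
  have h : ∀ j, (volume : Measure ℝ).withDensity ((m j).rnDeriv volume) = m j :=
    fun j => Measure.withDensity_rnDeriv_eq _ _ (hm j)
  have : ∀ j, SigmaFinite ((volume : Measure ℝ).withDensity ((m j).rnDeriv volume)) :=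
    fun j => by rw [h j]; infer_instance
  have hmp : Measurable fun y : Fin k → ℝ => ∏ j, (m j).rnDeriv volume (y j) :=
    Finset.measurable_prod _ fun j _ =>
      (Measure.measurable_rnDeriv _ _).comp (measurable_pi_apply j)
  calc Measure.pi m = Measure.pi fun j => (volume : Measure ℝ).withDensity ((m j).rnDeriv volume) := by
        simp_rw [h]
    _ = volume.withDensity fun y => ∏ j, (m j).rnDeriv volume (y j) :=
        pi_withDensity _ fun j => Measure.measurable_rnDeriv _ _
    _ = _ := by
        rw [expDensity, ← withDensity_mul _ (by fun_prop) (by fun_prop)]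
        congr 1
        ext1 y
        simp only [Pi.mul_apply]
        rw [← mul_assoc, ← ENNReal.ofReal_mul (Real.exp_pos _).le, ← Real.exp_add]
        simp

theorem pi_absolutelyContinuous_expDensity {k : ℕ} {W : (Fin k → ℝ) → ℝ} (hW : Measurable W)
    {m : Fin k → Measure ℝ} [∀ j, IsProbabilityMeasure (m j)] (hm : ∀ j, m j ≪ volume) :
    Measure.pi m ≪ expDensity W := by
  rw [pi_eq_expDensity_withDensity hW hm]
  exact withDensity_absolutelyContinuous _ _

theorem absolutelyContinuous_of_pi {k : ℕ} {W : (Fin k → ℝ) → ℝ}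
    {m : Fin k → Measure ℝ} [∀ j, IsProbabilityMeasure (m j)]
    (h : Measure.pi m ≪ expDensity W) (j : Fin k) : m j ≪ volume := by
  have h1 : Measure.pi m ≪ Measure.pi fun _ : Fin k => (volume : Measure ℝ) :=
    h.trans (withDensity_absolutelyContinuous _ _)
  refine Measure.AbsolutelyContinuous.mk fun A hA hA0 => ?_
  have h2 := h1 ((Measure.quasiMeasurePreserving_eval
    (fun _ : Fin k => (volume : Measure ℝ)) j).preimage_null hA0)
  rwa [(measurePreserving_eval m j).measure_preimage hA.nullMeasurableSet] at h2

theorem llr_pi_ae_eq {k : ℕ} {W : (Fin k → ℝ) → ℝ} (hW : Measurable W)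
    [IsProbabilityMeasure (expDensity W)]
    {m : Fin k → Measure ℝ} [∀ j, IsProbabilityMeasure (m j)] (hm : ∀ j, m j ≪ volume) :
    llr (Measure.pi m) (expDensity W) =ᵐ[Measure.pi m]
      fun y => ∑ j, Real.log ((m j).rnDeriv volume (y j)).toReal + W y := by
  have hmp : Measurable fun y : Fin k → ℝ => ∏ j, (m j).rnDeriv volume (y j) :=
    Finset.measurable_prod _ fun j _ =>
      (Measure.measurable_rnDeriv _ _).comp (measurable_pi_apply j)
  have h1 := (pi_absolutelyContinuous_expDensity hW hm).ae_le
    (Measure.rnDeriv_withDensity (expDensity W)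
      (f := fun y => ENNReal.ofReal (Real.exp (W y)) * ∏ j, (m j).rnDeriv volume (y j))
      (by fun_prop))
  rw [← pi_eq_expDensity_withDensity hW hm] at h1
  have h2 := ae_pi_of_forall_ae fun j => Measure.rnDeriv_pos (hm j)
  have h3 := ae_pi_of_forall_ae fun j => (hm j).ae_le (Measure.rnDeriv_ne_top (m j) volume)
  filter_upwards [h1, h2, h3] with y hy1 hy2 hy3
  rw [llr, hy1, ENNReal.toReal_mul, ENNReal.toReal_ofReal (Real.exp_pos _).le,
    ENNReal.toReal_prod, Real.log_mul (Real.exp_pos _).ne', Real.log_exp, Real.log_prod, add_comm]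
  · exact fun j _ => (ENNReal.toReal_pos (hy2 j).ne' (hy3 j)).ne'
  · exact Finset.prod_ne_zero_iff.2 fun j _ => (ENNReal.toReal_pos (hy2 j).ne' (hy3 j)).ne'

/-- The log-likelihood ratio of a product law, in quantile coordinates. -/
noncomputable def quantileLlr {k : ℕ} (m : Fin k → Measure ℝ) (W : (Fin k → ℝ) → ℝ)
    (u : Fin k → ℝ) : ℝ :=
  ∑ j, Real.log ((m j).rnDeriv volume (quantile (m j) (u j))).toReal +
    W fun j => quantile (m j) (u j)

theorem quantileLlr_integrable_and_integral {k : ℕ} {W : (Fin k → ℝ) → ℝ} (hW : Measurable W)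
    [IsProbabilityMeasure (expDensity W)]
    {m : Fin k → Measure ℝ} [∀ j, IsProbabilityMeasure (m j)]
    (h : klDiv (Measure.pi m) (expDensity W) ≠ ⊤) :
    Integrable (quantileLlr m W) (unifPi k) ∧
      ∫ u, quantileLlr m W u ∂(unifPi k) = (klDiv (Measure.pi m) (expDensity W)).toReal := by
  obtain ⟨hac, hint⟩ := klDiv_ne_top_iff.1 h
  have hm := absolutelyContinuous_of_pi hac
  have hae := llr_pi_ae_eq hW hm
  have hI := hint.congr hae
  rw [toReal_klDiv_eq_integral_llr h, integral_congr_ae hae]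
  rw [← map_quantile_pi m] at hI
  conv_rhs => rw [← map_quantile_pi m]
  rw [integral_map (measurable_quantile_pi m).aemeasurable hI.1]
  exact ⟨hI.comp_measurable (measurable_quantile_pi m), rfl⟩

/-- One-dimensional change of variables along a monotone function. -/
theorem exists_map_withDensity_eq_restrict {S s : ℝ → ℝ} (hS : Measurable S)
    (hmono : MonotoneOn S (Set.Ioo 0 1)) (hd : ∀ᵐ u ∂unif, HasDerivAt S (s u) u) :
    ∃ B : Set ℝ, (unif.withDensity fun u => ENNReal.ofReal (s u)).map S = volume.restrict B := by
  obtain ⟨A, hA, hAm, hAd⟩ := (hd.and ae_unif_mem).exists_measurable_mem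
  have hAu : unif = volume.restrict A := by
    rw [unif, ← Measure.restrict_eq_self_of_ae_mem (s := A) (μ := volume.restrict (Set.Ioo 0 1))
      (by exact hA), Measure.restrict_restrict hAm,
      Set.inter_eq_left.2 fun u hu => (hAd u hu).2]
  refine ⟨S '' A, Measure.ext fun C hC => ?_⟩
  have h := lintegral_image_eq_lintegral_deriv_mul_of_monotoneOn hAm
    (fun u hu => (hAd u hu).1.hasDerivWithinAt) (hmono.mono fun u hu => (hAd u hu).2)
    (C.indicator 1)
  rw [Measure.map_apply hS hC, withDensity_apply _ (hS hC), ← lintegral_indicator (hS hC), hAu,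
    ← lintegral_indicator_one hC, h]
  refine lintegral_congr fun u => ?_
  by_cases hu : S u ∈ C
  · simp [hu, Set.indicator]
  · simp [hu, Set.indicator]

theorem lintegral_pi_comp_mul_deriv_le {k : ℕ} {S s : Fin k → ℝ → ℝ} (hS : ∀ j, Measurable (S j))
    (hs : ∀ j, Measurable (s j)) (hmono : ∀ j, MonotoneOn (S j) (Set.Ioo 0 1))
    (hd : ∀ j, ∀ᵐ u ∂unif, HasDerivAt (S j) (s j u) u) {Φ : (Fin k → ℝ) → ℝ≥0∞}
    (hΦ : Measurable Φ) :
    ∫⁻ u, Φ (fun j => S j (u j)) * ∏ j, ENNReal.ofReal (s j (u j)) ∂(unifPi k) ≤ ∫⁻ y, Φ y := by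
  choose B hB using fun j => exists_map_withDensity_eq_restrict (hS j) (hmono j) (hd j)
  have hsig : ∀ j, SigmaFinite ((unif.withDensity fun u => ENNReal.ofReal (s j u)).map (S j)) :=
    fun j => by rw [hB j]; infer_instance
  have hSm : Measurable fun (u : Fin k → ℝ) j => S j (u j) :=
    measurable_pi_lambda _ fun j => (hS j).comp (measurable_pi_apply j)
  have h1 := pi_withDensity (fun _ : Fin k => unif)
    (f := fun j u => ENNReal.ofReal (s j u)) fun j => (hs j).ennreal_ofReal
  calc ∫⁻ u, Φ (fun j => S j (u j)) * ∏ j, ENNReal.ofReal (s j (u j)) ∂(unifPi k)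
      = ∫⁻ u, Φ (fun j => S j (u j))
          ∂(Measure.pi fun j => unif.withDensity fun u => ENNReal.ofReal (s j u)) := by
        have hΦS : Measurable fun u : Fin k → ℝ => Φ fun j => S j (u j) := hΦ.comp hSm
        rw [h1, lintegral_withDensity_eq_lintegral_mul _ _ hΦS]
        · simp [mul_comm]
        · exact Finset.measurable_prod _ fun j _ =>
            ((hs j).comp (measurable_pi_apply j)).ennreal_ofReal
    _ = ∫⁻ y, Φ y ∂(Measure.pi fun j => volume.restrict (B j)) := by
        simp_rw [← hB]
        rw [← Measure.pi_map_pi fun j => (hS j).aemeasurable, lintegral_map hΦ hSm]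
    _ ≤ ∫⁻ y, Φ y := by
        rw [← Measure.restrict_pi_pi]
        exact lintegral_mono' Measure.restrict_le_self le_rfl

/-- Midpoint strong convexity on `ℝ^k`. -/
def StrongMidConvex {k : ℕ} (α : ℝ) (W : (Fin k → ℝ) → ℝ) : Prop :=
  ∀ x y : Fin k → ℝ, W (fun i => (x i + y i) / 2) ≤
    (W x + W y) / 2 - α / 8 * ∑ i, (x i - y i) ^ 2

theorem neg_log_add_inv_div_two_le {a b : ℝ} (ha : 0 < a) (hb : 0 < b) :
    -Real.log ((a⁻¹ + b⁻¹) / 2) ≤ (Real.log a + Real.log b) / 2 := by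
  have h : Real.log (a⁻¹ * b⁻¹) ≤ Real.log (((a⁻¹ + b⁻¹) / 2) ^ 2) := by
    refine Real.log_le_log (by positivity) ?_
    nlinarith [sq_nonneg (a⁻¹ - b⁻¹)]
  rw [Real.log_pow, Real.log_mul (by positivity) (by positivity), Real.log_inv, Real.log_inv] at h
  push_cast at h
  linarith

theorem toReal_hval_add_le {k : ℕ} {α : ℝ} (hα : 0 < α) {W : (Fin k → ℝ) → ℝ} (hW : Measurable W)
    [IsProbabilityMeasure (expDensity W)] (hc : StrongMidConvex α W)
    {m₀ m₁ : Fin k → Measure ℝ} [∀ j, IsProbabilityMeasure (m₀ j)]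
    [∀ j, IsProbabilityMeasure (m₁ j)]
    (h₀ : klDiv (Measure.pi m₀) (expDensity W) ≠ ⊤)
    (h₁ : klDiv (Measure.pi m₁) (expDensity W) ≠ ⊤) (i : Fin k) :
    (hval (expDensity W)).toReal +
        α / 8 * ∫ u, min ((quantile (m₀ i) u - quantile (m₁ i) u) ^ 2) 1 ∂unif ≤
      ((klDiv (Measure.pi m₀) (expDensity W)).toReal +
        (klDiv (Measure.pi m₁) (expDensity W)).toReal) / 2 := by
  obtain ⟨hI₀, hK₀⟩ := quantileLlr_integrable_and_integral hW h₀
  obtain ⟨hI₁, hK₁⟩ := quantileLlr_integrable_and_integral hW h₁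
  set τ := expDensity W with hτ
  set f₀ : Fin k → ℝ → ℝ := fun j u => ((m₀ j).rnDeriv volume (quantile (m₀ j) u)).toReal with hf₀
  set f₁ : Fin k → ℝ → ℝ := fun j u => ((m₁ j).rnDeriv volume (quantile (m₁ j) u)).toReal with hf₁
  set S : Fin k → ℝ → ℝ := fun j u => (quantile (m₀ j) u + quantile (m₁ j) u) / 2 with hS
  set s : Fin k → ℝ → ℝ := fun j u => ((f₀ j u)⁻¹ + (f₁ j u)⁻¹) / 2 with hs
  have hSm : ∀ j, Measurable (S j) := fun j =>
    ((measurable_quantile _).add (measurable_quantile _)).div_const 2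
  have hsm : ∀ j, Measurable (s j) := fun j =>
    ((((Measure.measurable_rnDeriv _ _).comp (measurable_quantile _)).ennreal_toReal.inv).add
      (((Measure.measurable_rnDeriv _ _).comp (measurable_quantile _)).ennreal_toReal.inv)).div_const
        2
  have hac₀ := absolutelyContinuous_of_pi (klDiv_ne_top_iff.1 h₀).1
  have hac₁ := absolutelyContinuous_of_pi (klDiv_ne_top_iff.1 h₁).1
  have hd₀ := fun j => ae_hasDerivAt_quantile (hac₀ j)
  have hd₁ := fun j => ae_hasDerivAt_quantile (hac₁ j)
  have hmono : ∀ j, MonotoneOn (S j) (Set.Ioo 0 1) := fun j u hu v hv huv => by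
    have h1 := monotoneOn_quantile (m₀ j) hu hv huv
    have h2 := monotoneOn_quantile (m₁ j) hu hv huv
    simp only [hS]
    linarith
  have hSd : ∀ j, ∀ᵐ u ∂unif, HasDerivAt (S j) (s j u) u := fun j => by
    filter_upwards [hd₀ j, hd₁ j] with u hu₀ hu₁
    exact (hu₀.2.add hu₁.2).div_const 2
  have hSpi : Measurable fun (u : Fin k → ℝ) j => S j (u j) :=
    measurable_pi_lambda _ fun j => (hSm j).comp (measurable_pi_apply j)
  set D : ℝ → ℝ := fun u => min ((quantile (m₀ i) u - quantile (m₁ i) u) ^ 2) 1 with hD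
  have hDm : Measurable D :=
    (((measurable_quantile _).sub (measurable_quantile _)).pow_const 2).min measurable_const
  have hDI : Integrable D unif := integrable_of_abs_le (M := 1) hDm fun u => by
    rw [abs_of_nonneg (by positivity)]
    exact min_le_right _ _
  have hDI' : Integrable (fun u : Fin k → ℝ => D (u i)) (unifPi k) :=
    (measurePreserving_eval (fun _ : Fin k => unif) i).integrable_comp_of_integrable hDI
  have hDint : ∫ u : Fin k → ℝ, D (u i) ∂(unifPi k) = ∫ u, D u ∂unif := by
    have h := (measurePreserving_eval (fun _ : Fin k => unif) i).map_eq
    conv_rhs => rw [← h]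
    exact (integral_map (measurable_pi_apply i).aemeasurable
      (by rw [h]; exact hDI.aestronglyMeasurable)).symm
  set C : ℝ := ((klDiv (Measure.pi m₀) τ).toReal + (klDiv (Measure.pi m₁) τ).toReal) / 2 -
    α / 8 * ∫ u, D u ∂unif with hC
  have key : ∀ φ : (Fin k → ℝ) →ᵇ ℝ, ∫ u, φ (fun j => S j (u j)) ∂(unifPi k) ≤
      C + Real.log (∫ y, Real.exp (φ y) ∂τ) := fun φ => by
    have hφm : Measurable φ := φ.continuous.measurable
    have hφS : Integrable (fun u : Fin k → ℝ => φ (fun j => S j (u j))) (unifPi k) :=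
      integrable_of_abs_le (M := ‖φ‖) (hφm.comp hSpi) fun u => φ.norm_coe_le_norm _
    have hφe : Integrable (fun y => Real.exp (φ y)) τ :=
      integrable_exp_of_abs_le (M := ‖φ‖) hφm fun u => φ.norm_coe_le_norm _
    have hψ : Integrable (fun u : Fin k → ℝ => (φ (fun j => S j (u j)) + α / 8 * D (u i)) -
        (quantileLlr m₀ W u + quantileLlr m₁ W u) / 2) (unifPi k) :=
      (hφS.add (hDI'.const_mul _)).sub ((hI₀.add hI₁).div_const 2)
    have hexp : ∫⁻ u, ENNReal.ofReal (Real.exp ((φ (fun j => S j (u j)) + α / 8 * D (u i)) -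
        (quantileLlr m₀ W u + quantileLlr m₁ W u) / 2)) ∂(unifPi k) ≤
        ENNReal.ofReal (∫ y, Real.exp (φ y) ∂τ) := by
      calc _ ≤ ∫⁻ u, (ENNReal.ofReal (Real.exp (-W fun j => S j (u j))) *
              ENNReal.ofReal (Real.exp (φ fun j => S j (u j)))) *
              ∏ j, ENNReal.ofReal (s j (u j)) ∂(unifPi k) := by
            refine lintegral_mono_ae ?_
            filter_upwards [ae_pi_of_forall_ae (μ := fun _ : Fin k => unif) hd₀,
              ae_pi_of_forall_ae (μ := fun _ : Fin k => unif) hd₁] with u hu₀ hu₁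
            have hspos : ∀ j, 0 < s j (u j) := fun j => by
              have h1 : 0 < f₀ j (u j) := (hu₀ j).1
              have h2 : 0 < f₁ j (u j) := (hu₁ j).1
              simp only [hs]
              positivity
            rw [← ENNReal.ofReal_mul (Real.exp_pos _).le,
              ← ENNReal.ofReal_prod_of_nonneg fun j _ => (hspos j).le,
              ← ENNReal.ofReal_mul (by positivity)]
            refine ENNReal.ofReal_le_ofReal ?_
            rw [← Real.exp_log (Finset.prod_pos fun j _ => hspos j), ← Real.exp_add,
              ← Real.exp_add, Real.exp_le_exp, Real.log_prod fun j _ => (hspos j).ne']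
            have hWc := hc (fun j => quantile (m₀ j) (u j)) fun j => quantile (m₁ j) (u j)
            have hlog : ∑ j, -Real.log (s j (u j)) ≤
                ∑ j, (Real.log (f₀ j (u j)) + Real.log (f₁ j (u j))) / 2 :=
              Finset.sum_le_sum fun j _ => neg_log_add_inv_div_two_le (hu₀ j).1 (hu₁ j).1
            have hDle : D (u i) ≤ ∑ j, (quantile (m₀ j) (u j) - quantile (m₁ j) (u j)) ^ 2 :=
              (min_le_left _ _).trans (Finset.single_le_sum
                (f := fun j => (quantile (m₀ j) (u j) - quantile (m₁ j) (u j)) ^ 2)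
                (fun j _ => sq_nonneg _) (Finset.mem_univ i))
            rw [Finset.sum_neg_distrib, ← Finset.sum_div, Finset.sum_add_distrib] at hlog
            have hDle' := mul_le_mul_of_nonneg_left hDle (by positivity : 0 ≤ α / 8)
            simp only [quantileLlr, hS]
            simp only [hf₀, hf₁] at hlog
            linarith
        _ ≤ ∫⁻ y, ENNReal.ofReal (Real.exp (-W y)) * ENNReal.ofReal (Real.exp (φ y)) :=
            lintegral_pi_comp_mul_deriv_le hSm hsm hmono hSd
              (Φ := fun y => ENNReal.ofReal (Real.exp (-W y)) * ENNReal.ofReal (Real.exp (φ y)))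
              (by fun_prop)
        _ = ∫⁻ y, ENNReal.ofReal (Real.exp (φ y)) ∂τ := by
            rw [hτ, expDensity, lintegral_withDensity_eq_lintegral_mul _ (by fun_prop)
              (by fun_prop)]
            rfl
        _ = _ := (ofReal_integral_eq_lintegral_ofReal hφe
            (ae_of_all _ fun y => (Real.exp_pos _).le)).symm
    have h := integral_le_log_of_lintegral_exp_le hψ hexp
    rw [integral_sub (f := fun u : Fin k → ℝ => φ (fun j => S j (u j)) + α / 8 * D (u i))
        (g := fun u => (quantileLlr m₀ W u + quantileLlr m₁ W u) / 2)
        (hφS.add (hDI'.const_mul _)) ((hI₀.add hI₁).div_const 2),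
      integral_add hφS (hDI'.const_mul _), integral_const_mul, hDint, integral_div,
      integral_add hI₀ hI₁, hK₀, hK₁] at h
    linarith
  have hC0 : 0 ≤ C := by simpa using key 0
  have hPS : ∀ j, IsProbabilityMeasure (unif.map (S j)) := fun j =>
    Measure.isProbabilityMeasure_map (hSm j).aemeasurable
  have hmap : (unifPi k).map (fun u j => S j (u j)) = Measure.pi fun j => unif.map (S j) :=
    Measure.pi_map_pi fun j => (hSm j).aemeasurable
  have hkl : klDiv (Measure.pi fun j => unif.map (S j)) τ ≤ ENNReal.ofReal C := by
    refine klDiv_le_of_forall_boundedContinuous fun φ => ?_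
    rw [← hmap, integral_map hSpi.aemeasurable φ.continuous.aestronglyMeasurable]
    exact key φ
  have hle : hval τ ≤ ENNReal.ofReal C := by
    refine le_trans (iInf₂_le (Measure.pi fun j => unif.map (S j)) ⟨_, hPS, rfl⟩) ?_
    rwa [KL_eq_klDiv]
  have := ENNReal.toReal_le_of_le_ofReal hC0 hle
  linarith

theorem klDiv_cond_eq {E : Type*} [MeasurableSpace E] {μ τ : Measure E} [IsProbabilityMeasure μ]
    [IsProbabilityMeasure τ] (h : klDiv μ τ ≠ ⊤) {A : Set E} (hA : MeasurableSet A)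
    (hA0 : μ A ≠ 0) :
    klDiv (μ[|A]) τ =
      ENNReal.ofReal ((μ.real A)⁻¹ * ∫ x in A, llr μ τ x ∂μ - Real.log (μ.real A)) := by
  obtain ⟨hac, hint⟩ := klDiv_ne_top_iff.1 h
  have := cond_isProbabilityMeasure (μ := μ) hA0
  have hcac : μ[|A] ≪ μ := cond_absolutelyContinuous
  have ha : 0 < μ.real A := ENNReal.toReal_pos hA0 (measure_ne_top _ _)
  have hd : μ[|A].rnDeriv τ =ᵐ[τ] (μ A)⁻¹ • A.indicator (μ.rnDeriv τ) := by
    have h1 := Measure.rnDeriv_smul_left_of_ne_top (μ.restrict A) τ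
      (r := (μ A)⁻¹) (ENNReal.inv_ne_top.2 hA0)
    filter_upwards [h1, Measure.rnDeriv_restrict μ τ hA] with x hx hx'
    rw [ProbabilityTheory.cond, hx, Pi.smul_apply, hx', Pi.smul_apply]
  have hmem : ∀ᵐ x ∂μ[|A], x ∈ A := by
    rw [ProbabilityTheory.cond]
    exact Measure.ae_smul_measure (ae_restrict_mem hA) _
  have hl : llr (μ[|A]) τ =ᵐ[μ[|A]] fun x => llr μ τ x - Real.log (μ.real A) := by
    filter_upwards [(hcac.trans hac).ae_le hd, hmem, hcac.ae_le (Measure.rnDeriv_pos hac),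
      (hcac.trans hac).ae_le (Measure.rnDeriv_ne_top μ τ)] with x hx hxA hx0 hx1
    have hp := ENNReal.toReal_pos hx0.ne' hx1
    rw [llr, hx, Pi.smul_apply, Set.indicator_of_mem hxA, smul_eq_mul, ENNReal.toReal_mul,
      ENNReal.toReal_inv, ← Measure.real, Real.log_mul (inv_ne_zero ha.ne') hp.ne', Real.log_inv, llr]
    ring
  have hI : Integrable (llr μ τ) (μ[|A]) := by
    rw [ProbabilityTheory.cond]
    exact hint.restrict.smul_measure (ENNReal.inv_ne_top.2 hA0)
  have hI' : Integrable (fun x => llr μ τ x - Real.log (μ.real A)) (μ[|A]) :=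
    hI.sub (integrable_const _)
  rw [klDiv_of_ac_of_integrable (hcac.trans hac) (hI'.congr hl.symm), integral_congr_ae hl,
    integral_sub hI (integrable_const _)]
  simp only [integral_const, probReal_univ, one_smul, add_sub_cancel_right]
  congr 2
  rw [ProbabilityTheory.cond, integral_smul_measure, ENNReal.toReal_inv, smul_eq_mul, Measure.real]

theorem eventually_klDiv_cond_lt {E : Type*} [MeasurableSpace E] {μ τ : Measure E}
    [IsProbabilityMeasure μ] [IsProbabilityMeasure τ] {r : ℝ≥0∞} (h : klDiv μ τ < r)
    {A : ℕ → Set E} (hA : ∀ n, MeasurableSet (A n)) (hmono : Monotone A)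
    (hU : ⋃ n, A n = Set.univ) :
    ∀ᶠ n in atTop, μ (A n) ≠ 0 ∧ klDiv (μ[|A n]) τ < r := by
  have hne := h.ne_top
  obtain ⟨hac, hint⟩ := klDiv_ne_top_iff.1 hne
  have h1 : Tendsto (fun n => μ (A n)) atTop (𝓝 1) := by
    have := tendsto_measure_iUnion_atTop (μ := μ) hmono
    rwa [hU, measure_univ] at this
  have h1' : Tendsto (fun n => μ.real (A n)) atTop (𝓝 1) :=
    (ENNReal.tendsto_toReal ENNReal.one_ne_top).comp h1
  have h2 : Tendsto (fun n => ∫ x in A n, llr μ τ x ∂μ) atTop (𝓝 (klDiv μ τ).toReal) := by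
    have := tendsto_setIntegral_of_monotone hA hmono (hint.integrableOn (s := ⋃ n, A n))
    rwa [hU, setIntegral_univ, ← toReal_klDiv_eq_integral_llr hne] at this
  have h3 : Tendsto (fun n => ENNReal.ofReal ((μ.real (A n))⁻¹ * ∫ x in A n, llr μ τ x ∂μ -
      Real.log (μ.real (A n)))) atTop (𝓝 (klDiv μ τ)) := by
    have := ENNReal.tendsto_ofReal
      (((h1'.inv₀ one_ne_zero).mul h2).sub (h1'.log one_ne_zero))
    simpa [hne] using this
  have h4 : ∀ᶠ n in atTop, μ (A n) ≠ 0 :=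
    h1.eventually (isOpen_ne.mem_nhds one_ne_zero)
  filter_upwards [h4, h3.eventually (gt_mem_nhds h)] with n hn hn'
  exact ⟨hn, by rwa [klDiv_cond_eq hne (hA n) hn]⟩

theorem pi_cond {k : ℕ} {m : Fin k → Measure ℝ} [∀ j, IsProbabilityMeasure (m j)]
    {I : Set ℝ} (hI : MeasurableSet I) (h0 : ∀ j, m j I ≠ 0) :
    Measure.pi (fun j => (m j)[|I]) = (Measure.pi m)[|Set.univ.pi fun _ => I] := by
  have := fun j => cond_isProbabilityMeasure (μ := m j) (h0 j)
  refine Measure.pi_eq fun s hs => ?_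
  rw [cond_apply (MeasurableSet.univ_pi fun _ => hI), ← Set.pi_inter_distrib, Measure.pi_pi,
    Measure.pi_pi]
  simp_rw [cond_apply hI]
  rw [Finset.prod_mul_distrib, ENNReal.prod_inv_distrib]
  intro i _ j _ _
  exact Or.inr (measure_ne_top _ _)

/-- Product laws with compact support and finite entropy. -/
structure CompactEntropy {k : ℕ} (m : Fin k → Measure ℝ) : Prop where
  prob : ∀ j, IsProbabilityMeasure (m j)
  supp : ∃ R : ℝ, ∀ j, ∀ᵐ x ∂(m j), x ∈ Set.Icc (-R) R
  ac : ∀ j, m j ≪ volume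
  int : Integrable (fun y : Fin k → ℝ => ∑ j, Real.log ((m j).rnDeriv volume (y j)).toReal)
    (Measure.pi m)

theorem compactEntropy_unif (k : ℕ) : CompactEntropy fun _ : Fin k => unif where
  prob _ := inferInstance
  supp := ⟨1, fun _ => ae_unif_mem.mono fun u hu => ⟨by linarith [hu.1], hu.2.le⟩⟩
  ac _ := Measure.restrict_le_self.absolutelyContinuous
  int := by
    refine (integrable_zero _ _ _).congr ?_
    have h : ∀ᵐ u ∂unif, unif.rnDeriv volume u = 1 := by
      filter_upwards [Measure.restrict_le_self.absolutelyContinuous.ae_le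
        (Measure.rnDeriv_restrict_self (volume : Measure ℝ) measurableSet_Ioo), ae_unif_mem]
        with u hu hu'
      exact hu.trans (by simp [hu'])
    filter_upwards [ae_pi_of_forall_ae (μ := fun _ : Fin k => unif) fun _ => h] with u hu
    simp [hu]

theorem CompactEntropy.pi_supp {k : ℕ} {m : Fin k → Measure ℝ} (h : CompactEntropy m) :
    ∃ K : Set (Fin k → ℝ), IsCompact K ∧ (Measure.pi m).restrict K = Measure.pi m := by
  have := h.prob
  obtain ⟨R, hR⟩ := h.supp
  refine ⟨Set.univ.pi fun _ => Set.Icc (-R) R, isCompact_univ_pi fun _ => isCompact_Icc, ?_⟩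
  refine Measure.restrict_eq_self_of_ae_mem ?_
  filter_upwards [ae_pi_of_forall_ae hR] with y hy j _
  exact hy j

theorem CompactEntropy.integrable_of_continuous {k : ℕ} {m : Fin k → Measure ℝ}
    (h : CompactEntropy m) {W : (Fin k → ℝ) → ℝ} (hW : Continuous W) :
    Integrable W (Measure.pi m) := by
  have := h.prob
  obtain ⟨K, hK, hKm⟩ := h.pi_supp
  rw [← hKm]
  exact hW.continuousOn.integrableOn_compact hK

/-- The energy of a product law, up to the normalization of the target. -/
noncomputable def energy {k : ℕ} (V : ℝ × (Fin k → ℝ) → ℝ) (m : Fin k → Measure ℝ) (z : ℝ) : ℝ :=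
  ∫ y, ∑ j, Real.log ((m j).rnDeriv volume (y j)).toReal ∂(Measure.pi m) +
    ∫ y, V (z, y) ∂(Measure.pi m)

theorem CompactEntropy.continuous_energy {k : ℕ} {m : Fin k → Measure ℝ}
    (h : CompactEntropy m) {V : ℝ × (Fin k → ℝ) → ℝ} (hV : Continuous V) :
    Continuous (energy V m) := by
  have := h.prob
  obtain ⟨K, hK, hKm⟩ := h.pi_supp
  unfold energy
  refine continuous_const.add ?_
  rw [← hKm]
  exact continuous_parametric_integral_of_continuous (f := fun z y => V (z, y)) hV hK

theorem CompactEntropy.klDiv_eq {k : ℕ} {m : Fin k → Measure ℝ}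
    (h : CompactEntropy m) {V : ℝ × (Fin k → ℝ) → ℝ} (hV : Continuous V) {z c : ℝ}
    [IsProbabilityMeasure (expDensity fun y => V (z, y) + c)] :
    klDiv (Measure.pi m) (expDensity fun y => V (z, y) + c) = ENNReal.ofReal (energy V m z + c) ∧
      0 ≤ energy V m z + c := by
  have := h.prob
  have hVz : Continuous fun y => V (z, y) := by fun_prop
  have hW : Measurable fun y => V (z, y) + c := by fun_prop
  have hl := llr_pi_ae_eq hW h.ac
  have hac := pi_absolutelyContinuous_expDensity hW h.ac
  have hI := h.integrable_of_continuous hVz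
  have hIc : Integrable (fun y => V (z, y) + c) (Measure.pi m) := hI.add (integrable_const c)
  have hll := (h.int.add hIc).congr hl.symm
  have heq : ∫ y, llr (Measure.pi m) (expDensity fun y => V (z, y) + c) y ∂(Measure.pi m) =
      energy V m z + c := by
    rw [integral_congr_ae hl, integral_add h.int hIc, integral_add hI (integrable_const c), energy]
    simp [add_assoc]
  have h0 := integral_llr_add_sub_measure_univ_nonneg hac hll
  rw [klDiv_of_ac_of_integrable hac hll, heq]
  rw [heq] at h0
  simpa using h0

theorem exists_compactEntropy_klDiv_lt {k : ℕ} {W : (Fin k → ℝ) → ℝ} (hW : Continuous W)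
    [IsProbabilityMeasure (expDensity W)] {r : ℝ≥0∞} (h : hval (expDensity W) < r) :
    ∃ m : Fin k → Measure ℝ, CompactEntropy m ∧ klDiv (Measure.pi m) (expDensity W) < r := by
  simp only [hval, iInf_lt_iff] at h
  obtain ⟨_, ⟨m, hm, rfl⟩, hlt⟩ := h
  rw [KL_eq_klDiv] at hlt
  have hac := absolutelyContinuous_of_pi (klDiv_ne_top_iff.1 hlt.ne_top).1
  have hev := eventually_klDiv_cond_lt hlt
    (A := fun n : ℕ => Set.univ.pi fun _ => Set.Icc (-(n : ℝ)) n)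
    (fun n => MeasurableSet.univ_pi fun _ => measurableSet_Icc)
    (fun a b hab => Set.pi_mono fun _ _ => Set.Icc_subset_Icc
      (neg_le_neg (Nat.cast_le.2 hab)) (Nat.cast_le.2 hab))
    (Set.eq_univ_of_forall fun y => by
      obtain ⟨n, hn⟩ := exists_nat_ge ‖y‖
      exact Set.mem_iUnion.2 ⟨n, fun j _ => abs_le.1 ((norm_le_pi_norm y j).trans hn)⟩)
  obtain ⟨n, hn0, hn⟩ := hev.exists
  set I : Set ℝ := Set.Icc (-(n : ℝ)) n
  rw [Measure.pi_pi] at hn0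
  have h0 : ∀ j, m j I ≠ 0 := fun j => Finset.prod_ne_zero_iff.1 hn0 j (Finset.mem_univ j)
  rw [← pi_cond measurableSet_Icc h0] at hn
  have hp := fun j => cond_isProbabilityMeasure (μ := m j) (h0 j)
  have hac' : ∀ j, (m j)[|I] ≪ volume := fun j => cond_absolutelyContinuous.trans (hac j)
  have hsupp : ∀ j, ∀ᵐ x ∂((m j)[|I]), x ∈ I := fun j =>
    Measure.ae_smul_measure (ae_restrict_mem measurableSet_Icc) _
  refine ⟨fun j => (m j)[|I], ⟨hp, ⟨n, hsupp⟩, hac', ?_⟩, hn⟩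
  have hWI : Integrable W (Measure.pi fun j => (m j)[|I]) := by
    have : (Measure.pi fun j => (m j)[|I]).restrict (Set.univ.pi fun _ => I) =
        Measure.pi fun j => (m j)[|I] := by
      refine Measure.restrict_eq_self_of_ae_mem ?_
      filter_upwards [ae_pi_of_forall_ae hsupp] with y hy j _
      exact hy j
    rw [← this]
    exact hW.continuousOn.integrableOn_compact (isCompact_univ_pi fun _ => isCompact_Icc)
  have hl := (klDiv_ne_top_iff.1 hn.ne_top).2.congr (llr_pi_ae_eq hW.measurable hac')
  refine (hl.sub hWI).congr (ae_of_all _ fun y => ?_)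
  simp [I]

theorem exists_seq_compactEntropy {k : ℕ} {V : ℝ × (Fin k → ℝ) → ℝ} (hV : Continuous V) :
    ∃ m : ℕ → Fin k → Measure ℝ, (∀ i, CompactEntropy (m i)) ∧
      ∀ m', CompactEntropy m' → ∀ z r, energy V m' z < r → ∃ i, energy V (m i) z < r := by
  set T : Set C(ℝ, ℝ) := {F | ∃ m : Fin k → Measure ℝ, CompactEntropy m ∧ ∀ z, F z = energy V m z}
  obtain ⟨t, htT, htc, hTt⟩ :=
    (TopologicalSpace.IsSeparable.of_separableSpace T).exists_countable_dense_subset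
  have hmem : ∀ m : Fin k → Measure ℝ, ∀ h : CompactEntropy m,
      (⟨energy V m, h.continuous_energy hV⟩ : C(ℝ, ℝ)) ∈ T := fun m h => ⟨m, h, fun _ => rfl⟩
  have hne : t.Nonempty := closure_nonempty_iff.1 ⟨_, hTt (hmem _ (compactEntropy_unif k))⟩
  obtain ⟨F, rfl⟩ := htc.exists_eq_range hne
  choose m hm hF using fun i => htT ⟨i, rfl⟩
  refine ⟨m, hm, fun m' hm' z r hr => ?_⟩
  have hopen : IsOpen {H : C(ℝ, ℝ) | H z < r} :=
    isOpen_lt (continuous_eval_const z) continuous_const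
  obtain ⟨_, hH, i, rfl⟩ := mem_closure_iff.1 (hTt (hmem m' hm')) _ hopen hr
  exact ⟨i, by rw [← hF]; exact hH⟩

/-- The normalizing constant of `exp (-V (z, ·))`. -/
noncomputable def partitionFn {k : ℕ} (V : ℝ × (Fin k → ℝ) → ℝ) (z : ℝ) : ℝ≥0∞ :=
  ∫⁻ y, ENNReal.ofReal (Real.exp (-V (z, y)))

/-- The normalized potential of the conditional law given the root. -/
noncomputable def condPotential {k : ℕ} (V : ℝ × (Fin k → ℝ) → ℝ) (z : ℝ) (y : Fin k → ℝ) : ℝ :=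
  V (z, y) + Real.log (partitionFn V z).toReal

theorem measurable_partitionFn {k : ℕ} {V : ℝ × (Fin k → ℝ) → ℝ} (hV : Continuous V) :
    Measurable (partitionFn V) :=
  Measurable.lintegral_prod_right' (f := fun p => ENNReal.ofReal (Real.exp (-V p))) (by fun_prop)

theorem partitionFn_pos {k : ℕ} {V : ℝ × (Fin k → ℝ) → ℝ} (hV : Continuous V) (z : ℝ) :
    0 < partitionFn V z := by
  rw [partitionFn, lintegral_pos_iff_support (by fun_prop)]
  have : (Function.support fun y => ENNReal.ofReal (Real.exp (-V (z, y)))) = Set.univ :=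
    Set.eq_univ_of_forall fun y => by simp [Real.exp_pos]
  rw [this]
  exact isOpen_univ.measure_pos _ Set.univ_nonempty

theorem ofReal_exp_neg_condPotential {k : ℕ} {V : ℝ × (Fin k → ℝ) → ℝ} (hV : Continuous V) {z : ℝ}
    (hz : partitionFn V z ≠ ⊤) (y : Fin k → ℝ) :
    ENNReal.ofReal (Real.exp (-condPotential V z y)) =
      (partitionFn V z)⁻¹ * ENNReal.ofReal (Real.exp (-V (z, y))) := by
  have hp := ENNReal.toReal_pos (partitionFn_pos hV z).ne' hz
  rw [condPotential, neg_add, add_comm, Real.exp_add, Real.exp_neg (Real.log _), Real.exp_log hp,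
    ENNReal.ofReal_mul (by positivity), ENNReal.ofReal_inv_of_pos hp, ENNReal.ofReal_toReal hz]

theorem isProbabilityMeasure_condPotential {k : ℕ} {V : ℝ × (Fin k → ℝ) → ℝ} (hV : Continuous V)
    {z : ℝ} (hz : partitionFn V z ≠ ⊤) : IsProbabilityMeasure (expDensity (condPotential V z)) := by
  refine ⟨?_⟩
  rw [expDensity, withDensity_apply _ MeasurableSet.univ, Measure.restrict_univ]
  simp_rw [ofReal_exp_neg_condPotential hV hz]
  rw [lintegral_const_mul _ (by fun_prop)]
  exact ENNReal.inv_mul_cancel (partitionFn_pos hV z).ne' hz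

theorem cauchySeq_of_tsum_lt_top {x : ℕ → ℝ}
    (h : ∑' n, ENNReal.ofReal (4 ^ n * min ((x n - x (n + 1)) ^ 2) 1) < ⊤) : CauchySeq x := by
  have h0 := ENNReal.tendsto_atTop_zero_of_tsum_ne_top h.ne
  refine cauchySeq_of_summable_dist ?_
  refine Summable.of_norm_bounded_eventually_nat (g := fun n => (1 / 2 : ℝ) ^ n)
    (summable_geometric_of_lt_one (by norm_num) (by norm_num)) ?_
  filter_upwards [h0.eventually (gt_mem_nhds one_pos)] with n hn
  rw [ENNReal.ofReal_lt_one] at hn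
  have h4 : (1 : ℝ) ≤ 4 ^ n := one_le_pow₀ (by norm_num)
  have h5 : (4 : ℝ) ^ n * (x n - x (n + 1)) ^ 2 < 1 := by
    rcases min_cases ((x n - x (n + 1)) ^ 2) 1 with h | h
    · rwa [h.1] at hn
    · rw [h.1] at hn
      linarith
  rw [Real.norm_eq_abs, abs_of_nonneg dist_nonneg, Real.dist_eq, one_div, inv_pow]
  have h6 : (x n - x (n + 1)) ^ 2 ≤ ((2 : ℝ) ^ n)⁻¹ ^ 2 := by
    rw [inv_pow, ← pow_mul, mul_comm n 2, pow_mul, ← one_div, le_div_iff₀ (by positivity)]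
    norm_num
    linarith
  exact abs_le_of_sq_le_sq h6 (by positivity)

open Classical in
theorem exists_kernel_attains_hval {k : ℕ} {α : ℝ} (hα : 0 < α) {V : ℝ × (Fin k → ℝ) → ℝ}
    (hV : Continuous V) (hc : ∀ z, StrongMidConvex α fun y => V (z, y)) :
    ∃ (κ : Fin k → Kernel ℝ ℝ) (H : ℝ → ℝ), (∀ j, IsMarkovKernel (κ j)) ∧ Measurable H ∧
      ∀ z, partitionFn V z ≠ ⊤ →
        hval (expDensity (condPotential V z)) = ENNReal.ofReal (H z) ∧ 0 ≤ H z ∧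
        KL (Measure.pi fun j => κ j z) (expDensity (condPotential V z)) =
          hval (expDensity (condPotential V z)) ∧
        ∀ ν, IsProductProb ν → KL ν (expDensity (condPotential V z)) =
          hval (expDensity (condPotential V z)) → ν = Measure.pi fun j => κ j z := by
  obtain ⟨m, hm, hdense⟩ := exists_seq_compactEntropy hV
  have hmp := fun i => (hm i).prob
  set G : Set ℝ := {z | partitionFn V z ≠ ⊤} with hG
  have hGm : MeasurableSet G := (measurable_partitionFn hV (measurableSet_singleton ⊤)).compl
  set c : ℕ → ℝ → ℝ := fun i z => energy V (m i) z + Real.log (partitionFn V z).toReal with hcdef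
  have hcm : ∀ i, Measurable (c i) := fun i =>
    ((hm i).continuous_energy hV).measurable.add
      (measurable_partitionFn hV).ennreal_toReal.log
  set H : ℝ → ℝ := fun z => ⨅ i, c i z with hH
  have hHm : Measurable H := Measurable.iInf hcm
  have hprob : ∀ z ∈ G, IsProbabilityMeasure (expDensity (condPotential V z)) := fun z hz =>
    isProbabilityMeasure_condPotential hV hz
  have hWc : ∀ z, Continuous (condPotential V z) := fun z => by
    unfold condPotential
    fun_prop
  have hWs : ∀ z, StrongMidConvex α (condPotential V z) := fun z x y => by
    have := hc z x y
    simp only [condPotential]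
    linarith
  have hkl : ∀ z ∈ G, ∀ m' : Fin k → Measure ℝ, CompactEntropy m' →
      klDiv (Measure.pi m') (expDensity (condPotential V z)) =
        ENNReal.ofReal (energy V m' z + Real.log (partitionFn V z).toReal) ∧
      0 ≤ energy V m' z + Real.log (partitionFn V z).toReal := fun z hz m' hm' =>
    have : IsProbabilityMeasure
        (expDensity fun y => V (z, y) + Real.log (partitionFn V z).toReal) := hprob z hz
    hm'.klDiv_eq hV (z := z) (c := Real.log (partitionFn V z).toReal)
  have hle : ∀ z ∈ G, ∀ m' : Fin k → Measure ℝ, (∀ j, IsProbabilityMeasure (m' j)) →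
      hval (expDensity (condPotential V z)) ≤
        klDiv (Measure.pi m') (expDensity (condPotential V z)) := fun z hz m' hm' => by
    have := hprob z hz
    rw [← KL_eq_klDiv]
    exact iInf₂_le _ ⟨m', hm', rfl⟩
  have hfin : ∀ z ∈ G, hval (expDensity (condPotential V z)) ≠ ⊤ := fun z hz =>
    ((hle z hz (m 0) (hmp 0)).trans_lt (by
      rw [(hkl z hz _ (hm 0)).1]; exact ENNReal.ofReal_lt_top)).ne
  have hge : ∀ z ∈ G, ∀ i, (hval (expDensity (condPotential V z))).toReal ≤ c i z := fun z hz i =>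
    ENNReal.toReal_le_of_le_ofReal (hkl z hz _ (hm i)).2
      ((hle z hz (m i) (hmp i)).trans (hkl z hz _ (hm i)).1.le)
  have hlt : ∀ z ∈ G, ∀ w, (hval (expDensity (condPotential V z))).toReal < w →
      ∃ i, c i z < w := fun z hz w hw => by
    have := hprob z hz
    obtain ⟨m', hm', h⟩ := exists_compactEntropy_klDiv_lt (hWc z)
      (r := ENNReal.ofReal w) ((ENNReal.lt_ofReal_iff_toReal_lt (hfin z hz)).2 hw)
    rw [(hkl z hz m' hm').1, ENNReal.ofReal_lt_ofReal_iff_of_nonneg (hkl z hz m' hm').2] at h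
    obtain ⟨i, hi⟩ := hdense m' hm' z (w - Real.log (partitionFn V z).toReal) (by linarith)
    exact ⟨i, by simp only [hcdef]; linarith⟩
  have hHeq : ∀ z ∈ G, H z = (hval (expDensity (condPotential V z))).toReal := fun z hz =>
    ciInf_eq_of_forall_ge_of_forall_gt_exists_lt (hge z hz) (hlt z hz)
  have hex : ∀ (n : ℕ) (z : ℝ), ∃ i, c i z < H z + (1 / 16) ^ n ∨ z ∉ G := fun n z => by
    by_cases hz : z ∈ G
    · obtain ⟨i, hi⟩ := hlt z hz (H z + (1 / 16) ^ n) (by rw [hHeq z hz]; simp)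
      exact ⟨i, Or.inl hi⟩
    · exact ⟨0, Or.inr hz⟩
  set idx : ℕ → ℝ → ℕ := fun n z => Nat.find (hex n z) with hidx
  have hidxm : ∀ n, Measurable (idx n) := fun n => measurable_find (hex n) fun i =>
    (measurableSet_lt (hcm i) (hHm.add_const _)).union hGm.compl
  have hidx_lt : ∀ n, ∀ z ∈ G, c (idx n z) z < H z + (1 / 16) ^ n := fun n z hz =>
    (Nat.find_spec (hex n z)).resolve_right fun h => h hz
  set X : ℕ → Fin k → ℝ × ℝ → ℝ := fun n j p => quantile (m (idx n p.1) j) p.2 with hX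
  have hXm : ∀ n j, Measurable (X n j) := fun n j => by
    have h1 : Measurable fun p : ℕ × ℝ => quantile (m p.1 j) p.2 :=
      measurable_from_prod_countable_right fun i => measurable_quantile (m i j)
    exact h1.comp (((hidxm n).comp measurable_fst).prodMk measurable_snd)
  set Y : Fin k → ℝ × ℝ → ℝ := fun j p => limUnder atTop fun n => X n j p with hY
  have hYm : ∀ j, Measurable (Y j) := fun j =>
    (StronglyMeasurable.limUnder fun n => (hXm n j).stronglyMeasurable).measurable
  have hYz : ∀ j z, Measurable fun u => Y j (z, u) := fun j z =>
    (hYm j).comp measurable_prodMk_left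
  have hconv : ∀ z ∈ G, ∀ j, ∀ᵐ u ∂unif,
      Tendsto (fun n => X n j (z, u)) atTop (𝓝 (Y j (z, u))) := fun z hz j => by
    have := hprob z hz
    set D : ℕ → ℝ → ℝ := fun n u => min ((X n j (z, u) - X (n + 1) j (z, u)) ^ 2) 1
    have hDm : ∀ n, Measurable (D n) := fun n =>
      ((((hXm n j).comp measurable_prodMk_left).sub
        ((hXm (n + 1) j).comp measurable_prodMk_left)).pow_const 2).min measurable_const
    have hD0 : ∀ n u, 0 ≤ D n u := fun n u => by positivity
    have hDI : ∀ n, Integrable (D n) unif := fun n =>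
      integrable_of_abs_le (M := 1) (hDm n) fun u => by
        rw [abs_of_nonneg (hD0 n u)]
        exact min_le_right _ _
    have hgap : ∀ n, ∫ u, D n u ∂unif ≤ 8 / α * (1 / 16) ^ n := fun n => by
      have h1 := hkl z hz _ (hm (idx n z))
      have h2 := hkl z hz _ (hm (idx (n + 1) z))
      have h := toReal_hval_add_le hα (hWc z).measurable (hWs z)
        (m₀ := m (idx n z)) (m₁ := m (idx (n + 1) z))
        (by rw [h1.1]; exact ENNReal.ofReal_ne_top) (by rw [h2.1]; exact ENNReal.ofReal_ne_top) j
      rw [h1.1, h2.1, ENNReal.toReal_ofReal h1.2, ENNReal.toReal_ofReal h2.2, ← hHeq z hz] at h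
      have h3 := hidx_lt n z hz
      have h4 := hidx_lt (n + 1) z hz
      have h5 : (1 / 16 : ℝ) ^ (n + 1) ≤ (1 / 16) ^ n :=
        pow_le_pow_of_le_one (by norm_num) (by norm_num) n.le_succ
      simp only [hcdef] at h3 h4
      change H z + α / 8 * ∫ u, D n u ∂unif ≤ _ at h
      have h6 : α / 8 * ∫ u, D n u ∂unif ≤ (1 / 16) ^ n := by linarith
      calc ∫ u, D n u ∂unif = 8 / α * (α / 8 * ∫ u, D n u ∂unif) := by field_simp
        _ ≤ _ := mul_le_mul_of_nonneg_left h6 (by positivity)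
    have hsum : ∀ᵐ u ∂unif, ∑' n, ENNReal.ofReal (4 ^ n * D n u) < ⊤ := by
      refine ae_lt_top (Measurable.tsum fun n => ((hDm n).const_mul _).ennreal_ofReal) ?_
      rw [lintegral_tsum fun n => ((hDm n).const_mul _).ennreal_ofReal.aemeasurable]
      have hs : Summable fun n : ℕ => 8 / α * (1 / 4 : ℝ) ^ n :=
        (summable_geometric_of_lt_one (by norm_num) (by norm_num)).mul_left _
      refine ((ENNReal.tsum_le_tsum fun n => ?_).trans_lt
        (hs.tsum_ofReal_lt_top)).ne
      rw [← ofReal_integral_eq_lintegral_ofReal ((hDI n).const_mul _)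
        (ae_of_all _ fun u => mul_nonneg (by positivity) (hD0 n u)), integral_const_mul]
      refine ENNReal.ofReal_le_ofReal ?_
      calc (4 : ℝ) ^ n * ∫ u, D n u ∂unif ≤ 4 ^ n * (8 / α * (1 / 16) ^ n) :=
            mul_le_mul_of_nonneg_left (hgap n) (by positivity)
        _ = 8 / α * (4 * (1 / 16)) ^ n := by rw [mul_pow]; ring
        _ = _ := by norm_num
    filter_upwards [hsum] with u hu
    exact CauchySeq.tendsto_limUnder (cauchySeq_of_tsum_lt_top hu)
  set κ : Fin k → Kernel ℝ ℝ := fun j =>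
    { toFun := fun z => unif.map fun u => Y j (z, u)
      measurable' := by
        refine Measure.measurable_of_measurable_coe _ fun s hs => ?_
        simp_rw [fun z => Measure.map_apply (μ := unif) (hYz j z) hs]
        exact measurable_measure_prodMk_left (hYm j hs) } with hκ
  have hκp : ∀ j z, IsProbabilityMeasure (κ j z) := fun j z =>
    Measure.isProbabilityMeasure_map (hYz j z).aemeasurable
  have hκm : ∀ j, IsMarkovKernel (κ j) := fun j => ⟨hκp j⟩
  refine ⟨κ, H, hκm, hHm, fun z hz => ?_⟩
  have := hprob z hz
  have hval_eq : hval (expDensity (condPotential V z)) = ENNReal.ofReal (H z) := by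
    rw [hHeq z hz, ENNReal.ofReal_toReal (hfin z hz)]
  have hmin : klDiv (Measure.pi fun j => κ j z) (expDensity (condPotential V z)) =
      hval (expDensity (condPotential V z)) := by
    refine le_antisymm ?_ (hle z hz _ fun j => hκp j z)
    have hmap : (unifPi k).map (fun u j => Y j (z, u j)) = Measure.pi fun j => κ j z :=
      have : ∀ j, SigmaFinite (unif.map fun u => Y j (z, u)) := fun j =>
        have := hκp j z
        inferInstanceAs (SigmaFinite (κ j z))
      Measure.pi_map_pi fun j => (hYz j z).aemeasurable
    have hYpi : Measurable fun (u : Fin k → ℝ) j => Y j (z, u j) :=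
      measurable_pi_lambda _ fun j => (hYz j z).comp (measurable_pi_apply j)
    have : IsProbabilityMeasure ((unifPi k).map fun u j => Y j (z, u j)) :=
      Measure.isProbabilityMeasure_map hYpi.aemeasurable
    rw [← hmap, hval_eq]
    refine klDiv_map_le_of_tendsto_ae (X := fun n u j => X n j (z, u j))
      (c := fun n => c (idx n z) z) (fun n => measurable_quantile_pi (m (idx n z))) hYpi ?_ ?_
      (fun n => (hkl z hz _ (hm (idx n z))).2) fun n => ?_
    · filter_upwards [ae_pi_of_forall_ae (μ := fun _ : Fin k => unif) (hconv z hz)] with u hu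
      exact tendsto_pi_nhds.2 hu
    · refine tendsto_of_tendsto_of_tendsto_of_le_of_le tendsto_const_nhds
        (h := fun n => H z + (1 / 16) ^ n) ?_ (fun n => ?_) fun n => (hidx_lt n z hz).le
      · simpa using (tendsto_pow_atTop_nhds_zero_of_lt_one (by norm_num : (0 : ℝ) ≤ 1 / 16)
          (by norm_num)).const_add (H z)
      · rw [hHeq z hz]
        exact hge z hz _
    · rw [← (hkl z hz _ (hm (idx n z))).1, ← map_quantile_pi (m (idx n z))]
  refine ⟨hval_eq, by rw [hHeq z hz]; positivity, by rw [KL_eq_klDiv, hmin], ?_⟩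
  rintro _ ⟨m', hm', rfl⟩ hν
  rw [KL_eq_klDiv] at hν
  congr 1
  ext1 i
  have h := toReal_hval_add_le hα (hWc z).measurable (hWs z) (m₀ := m') (m₁ := fun j => κ j z)
    (by rw [hν]; exact hfin z hz) (by rw [hmin]; exact hfin z hz) i
  rw [hν, hmin] at h
  have hDm : Measurable fun u => min ((quantile (m' i) u - quantile (κ i z) u) ^ 2) (1 : ℝ) :=
    (((measurable_quantile _).sub (measurable_quantile _)).pow_const 2).min measurable_const
  have hD0 : ∀ u, 0 ≤ min ((quantile (m' i) u - quantile (κ i z) u) ^ 2) (1 : ℝ) := fun u => by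
    positivity
  have hDI : Integrable (fun u => min ((quantile (m' i) u - quantile (κ i z) u) ^ 2) (1 : ℝ))
      unif := integrable_of_abs_le (M := 1) hDm fun u => by
    rw [abs_of_nonneg (hD0 u)]
    exact min_le_right _ _
  have h0 : ∫ u, min ((quantile (m' i) u - quantile (κ i z) u) ^ 2) 1 ∂unif = 0 := by
    refine le_antisymm ?_ (integral_nonneg hD0)
    have : α / 8 * ∫ u, min ((quantile (m' i) u - quantile (κ i z) u) ^ 2) 1 ∂unif ≤ 0 := by
      linarith
    exact nonpos_of_mul_nonpos_right this (by positivity)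
  rw [integral_eq_zero_iff_of_nonneg hD0 hDI] at h0
  rw [← map_quantile (m' i), ← map_quantile (κ i z)]
  refine Measure.map_congr ?_
  filter_upwards [h0] with u hu
  rcases min_cases ((quantile (m' i) u - quantile (κ i z) u) ^ 2) 1 with h | h
  · have : (quantile (m' i) u - quantile (κ i z) u) ^ 2 = 0 := h.1.symm.trans hu
    exact sub_eq_zero.1 (pow_eq_zero_iff two_ne_zero |>.1 this)
  · exact absurd (h.1.symm.trans hu) one_ne_zero

theorem strongMidConvex_of_strongConvexWith {k : ℕ} {V : ℝ × (Fin k → ℝ) → ℝ} {α : ℝ}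
    (h : StrongConvexWith α V) (z : ℝ) : StrongMidConvex α fun y => V (z, y) := fun x y => by
  have h1 := h (z, x) (z, y) (1 / 2) ⟨by norm_num, by norm_num⟩
  have h2 : (1 - 1 / 2 : ℝ) • (z, x) + (1 / 2 : ℝ) • (z, y) = (z, fun i => (x i + y i) / 2) := by
    ext i
    · simp; ring
    · simp; ring
  have h3 : sqNorm ((z, x) - (z, y)) = ∑ i, (x i - y i) ^ 2 := by simp [sqNorm]
  rw [h2, h3] at h1
  simp only
  linarith

/-- The conditional law of the leaves given the root under the Gibbs measure. -/
theorem cond_gibbs_ae_eq {k : ℕ} {V : ℝ × (Fin k → ℝ) → ℝ} (hV : Continuous V)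
    {π : Measure (ℝ × (Fin k → ℝ))} [IsProbabilityMeasure π] (hπ : π = gibbs V)
    {πcond : Kernel ℝ (Fin k → ℝ)} [IsMarkovKernel πcond] (hdis : π = π.fst ⊗ₘ πcond) :
    ∀ᵐ z ∂π.fst, partitionFn V z ≠ ⊤ ∧ πcond z = expDensity (condPotential V z) := by
  set f : ℝ × (Fin k → ℝ) → ℝ≥0∞ := fun p => ENNReal.ofReal (Real.exp (-V p)) with hf
  have hfm : Measurable f := by fun_prop
  have hpm := measurable_partitionFn hV
  set Z : ℝ≥0∞ := (volume.withDensity f) Set.univ with hZ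
  have hπ' : π = Z⁻¹ • volume.withDensity f := hπ
  have hZZ : Z⁻¹ * Z = 1 := by
    rw [← measure_univ (μ := π), hπ']
    simp [hZ]
  have hZtop : Z ≠ ⊤ := fun h => by simp [h] at hZZ
  have hfst : π.fst = volume.withDensity fun z => Z⁻¹ * partitionFn V z := by
    ext s hs
    rw [Measure.fst_apply hs, withDensity_apply _ hs, lintegral_const_mul _ hpm, hπ',
      Measure.smul_apply, withDensity_apply _ (measurable_fst hs), smul_eq_mul,
      Measure.volume_eq_prod, ← Set.prod_univ, ← Measure.prod_restrict, Measure.restrict_univ,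
      lintegral_prod _ hfm.aemeasurable]
    rfl
  have hfin : ∀ᵐ z, partitionFn V z ≠ ⊤ := by
    refine (ae_lt_top hpm ?_).mono fun z hz => hz.ne
    rwa [show ∫⁻ z, partitionFn V z = Z by
      rw [hZ, withDensity_apply _ MeasurableSet.univ, Measure.restrict_univ,
        Measure.volume_eq_prod, lintegral_prod _ hfm.aemeasurable]
      rfl]
  set g : ℝ → (Fin k → ℝ) → ℝ≥0∞ := fun z y => (partitionFn V z)⁻¹ * f (z, y) with hg
  have hgm : Measurable (Function.uncurry g) := (hpm.comp measurable_fst).inv.mul hfm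
  set τ : Kernel ℝ (Fin k → ℝ) := (Kernel.const ℝ volume).withDensity g with hτ
  have hτz : ∀ z, τ z = volume.withDensity (g z) := fun z => by
    rw [hτ, Kernel.withDensity_apply _ hgm, Kernel.const_apply]
  have hτfin : IsFiniteKernel τ := ⟨1, ENNReal.one_lt_top, fun z => by
    rw [hτz, withDensity_apply _ MeasurableSet.univ, Measure.restrict_univ,
      lintegral_const_mul _ (by fun_prop)]
    exact ENNReal.inv_mul_le_one _⟩
  have hτeq : π.fst ⊗ₘ πcond = π.fst ⊗ₘ τ := by
    have h1 : π.fst ⊗ₘ τ = ((volume.prod volume).withDensity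
        fun p => Z⁻¹ * partitionFn V p.1).withDensity fun p => g p.1 p.2 := by
      rw [hτ, Measure.compProd_withDensity hgm, Measure.compProd_const, hfst,
        prod_withDensity_left (hpm.const_mul _)]
    have h2 : Measurable fun p : ℝ × (Fin k → ℝ) => Z⁻¹ * partitionFn V p.1 :=
      (hpm.comp measurable_fst).const_mul _
    have h3 : Measurable fun p : ℝ × (Fin k → ℝ) => g p.1 p.2 := hgm
    rw [← hdis, h1, ← withDensity_mul _ h2 h3, ← Measure.volume_eq_prod]
    refine hπ'.trans ?_
    rw [← withDensity_smul _ hfm]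
    refine withDensity_congr_ae ?_
    have : ∀ᵐ p : ℝ × (Fin k → ℝ), partitionFn V p.1 ≠ ⊤ := by
      rw [Measure.volume_eq_prod]
      exact Measure.quasiMeasurePreserving_fst.ae hfin
    filter_upwards [this] with p hp
    simp only [Pi.smul_apply, Pi.mul_apply, smul_eq_mul, hg]
    rw [mul_assoc, ← mul_assoc (partitionFn V p.1),
      ENNReal.mul_inv_cancel (partitionFn_pos hV _).ne' hp, one_mul]
  have hac : π.fst ≪ volume := hfst ▸ withDensity_absolutelyContinuous _ _
  filter_upwards [Kernel.ae_eq_of_compProd_eq hτeq, hac.ae_le hfin] with z hz hz'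
  refine ⟨hz', ?_⟩
  rw [hz, hτz, expDensity]
  congr 1
  ext y
  exact (ofReal_exp_neg_condPotential hV hz' y).symm

/-- The kernel of product measures `z ↦ ⨂ j, κ j z`. -/
noncomputable def piKernel {k : ℕ} (κ : Fin k → Kernel ℝ ℝ) [∀ j, IsMarkovKernel (κ j)] :
    Kernel ℝ (Fin k → ℝ) where
  toFun z := Measure.pi fun j => κ j z
  measurable' := by
    refine Measurable.measure_of_isPiSystem_of_isProbabilityMeasure generateFrom_pi.symm
      isPiSystem_pi ?_
    rintro _ ⟨s, hs, rfl⟩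
    simp_rw [Measure.pi_pi]
    exact Finset.measurable_prod _ fun j _ => (κ j).measurable_coe (hs j (Set.mem_univ j))

instance {k : ℕ} (κ : Fin k → Kernel ℝ ℝ) [∀ j, IsMarkovKernel (κ j)] :
    IsMarkovKernel (piKernel κ) :=
  ⟨fun z => inferInstanceAs (IsProbabilityMeasure (Measure.pi fun j => κ j z))⟩

theorem starMeasure_eq_compProd {k : ℕ} (μ : Measure ℝ) [IsProbabilityMeasure μ]
    (κ : Fin k → Kernel ℝ ℝ) [∀ j, IsMarkovKernel (κ j)] :
    starMeasure μ κ = μ ⊗ₘ piKernel κ := by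
  have h : (fun z => (Measure.dirac z).prod (piKernel κ z)) = ⇑(Kernel.id ×ₖ piKernel κ) := by
    ext1 z
    rw [Kernel.prod_apply, Kernel.id_apply]
  rw [Measure.compProd_eq_comp_prod, starMeasure, ← h]
  rfl

theorem integrable_exp_neg_of_nonneg {X : Type*} [MeasurableSpace X] {ν : Measure X}
    [IsFiniteMeasure ν] {H : X → ℝ} (hH : Measurable H) (h0 : ∀ᵐ x ∂ν, 0 ≤ H x) :
    Integrable (fun x => Real.exp (-H x)) ν := by
  refine Integrable.of_bound (by fun_prop) 1 ?_
  filter_upwards [h0] with x hx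
  rw [Real.norm_eq_abs, abs_of_pos (Real.exp_pos _)]
  exact Real.exp_le_one_iff.2 (by linarith)

theorem klDiv_compProd_right {X Y : Type*} [MeasurableSpace X] [MeasurableSpace Y]
    [MeasurableSpace.CountableOrCountablyGenerated X Y] {μ : Measure X} [IsFiniteMeasure μ]
    {κ η : Kernel X Y} [IsMarkovKernel κ] [IsMarkovKernel η] (hac : ∀ᵐ x ∂μ, κ x ≪ η x) :
    AEMeasurable (fun x => klDiv (κ x) (η x)) μ ∧
      klDiv (μ ⊗ₘ κ) (μ ⊗ₘ η) = ∫⁻ x, klDiv (κ x) (η x) ∂μ := by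
  set f : X → Y → ℝ≥0∞ := κ.rnDeriv η
  have hfm : Measurable (Function.uncurry f) := by fun_prop
  set g : X × Y → ℝ≥0∞ := fun p => ENNReal.ofReal (klFun (f p.1 p.2).toReal)
  have hgm : Measurable g := (measurable_klFun.comp hfm.ennreal_toReal).ennreal_ofReal
  have hkl : ∀ᵐ x ∂μ, klDiv (κ x) (η x) = ∫⁻ y, g (x, y) ∂(η x) := by
    filter_upwards [hac] with x hx
    rw [klDiv_eq_lintegral_klFun_of_ac hx]
    refine lintegral_congr_ae ?_
    filter_upwards [κ.rnDeriv_eq_rnDeriv_measure (η := η) (a := x)] with y hy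
    rw [← hy]
  have hκ : ∀ᵐ x ∂μ, κ x = η.withDensity f x := by
    filter_upwards [hac] with x hx using (Kernel.withDensity_rnDeriv_eq hx).symm
  have hrn : (μ ⊗ₘ κ).rnDeriv (μ ⊗ₘ η) =ᵐ[μ ⊗ₘ η] fun p => f p.1 p.2 := by
    rw [Measure.compProd_congr hκ, Measure.compProd_withDensity hfm]
    exact Measure.rnDeriv_withDensity _ hfm
  refine ⟨⟨_, Measurable.lintegral_kernel_prod_right' hgm, hkl⟩, ?_⟩
  rw [klDiv_eq_lintegral_klFun_of_ac (Measure.absolutelyContinuous_compProd_right_iff.2 hac),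
    lintegral_congr_ae hkl, ← Measure.lintegral_compProd hgm]
  refine lintegral_congr_ae ?_
  filter_upwards [hrn] with p hp
  rw [hp]

/-- The Gibbs variational principle. -/
theorem klDiv_add_lintegral_eq {X : Type*} [MeasurableSpace X] {ν : Measure X}
    [IsProbabilityMeasure ν] {H : X → ℝ} (hH : Measurable H) (h0 : ∀ᵐ x ∂ν, 0 ≤ H x) :
    klDiv (ν.tilted fun x => -H x) ν +
        ∫⁻ x, ENNReal.ofReal (H x) ∂(ν.tilted fun x => -H x) ≠ ⊤ ∧
      ∀ μ : Measure X, IsProbabilityMeasure μ →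
        klDiv μ ν + ∫⁻ x, ENNReal.ofReal (H x) ∂μ ≠ ⊤ →
        klDiv μ ν + ∫⁻ x, ENNReal.ofReal (H x) ∂μ =
          klDiv (ν.tilted fun x => -H x) ν +
            ∫⁻ x, ENNReal.ofReal (H x) ∂(ν.tilted fun x => -H x) +
          klDiv μ (ν.tilted fun x => -H x) := by
  have hexp : Integrable (fun x => Real.exp (-H x)) ν := integrable_exp_neg_of_nonneg hH h0
  have hp := isProbabilityMeasure_tilted hexp
  set p := ν.tilted fun x => -H x with hpdef
  have hpν : p ≪ ν := tilted_absolutelyContinuous _ _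
  have hνp : ν ≪ p := absolutelyContinuous_tilted hexp
  have hM : 0 < ∫ x, Real.exp (-H x) ∂ν := integral_exp_pos hexp
  have hHp : Integrable H p := by
    rw [hpdef, integrable_tilted_iff (f := fun x => -H x) hexp]
    refine Integrable.of_bound (by fun_prop) 1 ?_
    filter_upwards [h0] with x hx
    rw [smul_eq_mul, Real.norm_eq_abs, abs_of_nonneg (by positivity), Real.exp_neg,
      inv_mul_le_one₀ (Real.exp_pos _)]
    linarith [Real.add_one_le_exp (H x)]
  have hllr : llr p ν =ᵐ[p] fun x => -H x - Real.log (∫ x, Real.exp (-H x) ∂ν) :=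
    hpν.ae_le (log_rnDeriv_tilted_left_self hexp)
  have hfin : klDiv p ν + ∫⁻ x, ENNReal.ofReal (H x) ∂p ≠ ⊤ := by
    refine ENNReal.add_ne_top.2 ⟨klDiv_ne_top hpν ?_, hHp.lintegral_lt_top.ne⟩
    exact (integrable_congr hllr).2 (hHp.neg.sub (integrable_const _))
  have key : ∀ μ : Measure X, IsProbabilityMeasure μ →
      klDiv μ ν + ∫⁻ x, ENNReal.ofReal (H x) ∂μ ≠ ⊤ → klDiv μ p ≠ ⊤ ∧
      (klDiv μ ν + ∫⁻ x, ENNReal.ofReal (H x) ∂μ).toReal =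
        (klDiv μ p).toReal - Real.log (∫ x, Real.exp (-H x) ∂ν) := fun μ _ h => by
    obtain ⟨h1, h2⟩ := ENNReal.add_ne_top.1 h
    obtain ⟨hac, hint⟩ := klDiv_ne_top_iff.1 h1
    have h0μ : ∀ᵐ x ∂μ, 0 ≤ H x := hac.ae_le h0
    have hHμ : Integrable H μ :=
      (lintegral_ofReal_ne_top_iff_integrable hH.aestronglyMeasurable h0μ).1 h2
    have h3 : klDiv μ p ≠ ⊤ := klDiv_ne_top (hac.trans hνp)
      (integrable_llr_tilted_right hac hHμ.neg hint hexp)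
    refine ⟨h3, ?_⟩
    have h4 := integral_llr_tilted_right hac hHμ.neg hexp hint
    rw [ENNReal.toReal_add h1 h2, toReal_klDiv_eq_integral_llr h1,
      toReal_klDiv_eq_integral_llr h3, ← integral_eq_lintegral_of_nonneg_ae h0μ
        hH.aestronglyMeasurable]
    simp only [Pi.neg_apply, integral_neg] at h4
    change ∫ x, llr μ p x ∂μ = _ at h4
    linarith
  refine ⟨hfin, fun μ hμ h => ?_⟩
  obtain ⟨h1, h2⟩ := key μ hμ h
  have h3 := (key p hp hfin).2
  rw [klDiv_self, ENNReal.toReal_zero] at h3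
  rw [← ENNReal.toReal_eq_toReal_iff' h (ENNReal.add_ne_top.2 ⟨hfin, h1⟩),
    ENNReal.toReal_add hfin h1, h2, h3]
  ring

theorem KL_starMeasure {k : ℕ} {π : Measure (ℝ × (Fin k → ℝ))} [IsProbabilityMeasure π]
    {πcond : Kernel ℝ (Fin k → ℝ)} [IsMarkovKernel πcond] (hdis : π = π.fst ⊗ₘ πcond)
    {μ : Measure ℝ} [IsProbabilityMeasure μ] {κ : Fin k → Kernel ℝ ℝ}
    [∀ j, IsMarkovKernel (κ j)] (hac : ∀ᵐ z ∂μ, piKernel κ z ≪ πcond z) :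
    AEMeasurable (fun z => klDiv (piKernel κ z) (πcond z)) μ ∧
      KL (starMeasure μ κ) π = klDiv μ π.fst + ∫⁻ z, klDiv (piKernel κ z) (πcond z) ∂μ := by
  obtain ⟨h1, h2⟩ := klDiv_compProd_right hac
  refine ⟨h1, ?_⟩
  rw [starMeasure_eq_compProd, KL_eq_klDiv, ← h2, ← klDiv_compProd_eq_add, ← hdis]

theorem isStar_starMeasure {k : ℕ} (μ : Measure ℝ) [IsProbabilityMeasure μ]
    (κ : Fin k → Kernel ℝ ℝ) [∀ j, IsMarkovKernel (κ j)] : IsStar (starMeasure μ κ) :=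
  ⟨by rw [starMeasure_eq_compProd]; infer_instance, μ, κ, inferInstance, inferInstance, rfl⟩

theorem tilted_neg_hval_eq {k : ℕ} {ν : Measure ℝ} {τ : Kernel ℝ (Fin k → ℝ)} {H : ℝ → ℝ}
    (h : ∀ᵐ z ∂ν, hval (τ z) = ENNReal.ofReal (H z) ∧ 0 ≤ H z) :
    (ν.tilted fun z => -H z) = ν.withDensity fun z =>
      ENNReal.ofReal ((∫ z, Real.exp (-H z) ∂ν)⁻¹ * Real.exp (-(hval (τ z)).toReal)) := by
  refine withDensity_congr_ae ?_
  filter_upwards [h] with z hz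
  rw [hz.1, ENNReal.toReal_ofReal hz.2, div_eq_inv_mul]

/-- Reduction of the star-structured problem to the inner mean-field problems. -/
theorem starMeasure_tilted_minimizes {k : ℕ} {π : Measure (ℝ × (Fin k → ℝ))}
    [IsProbabilityMeasure π] {πcond : Kernel ℝ (Fin k → ℝ)} [IsMarkovKernel πcond]
    (hdis : π = π.fst ⊗ₘ πcond) {κ : Fin k → Kernel ℝ ℝ} [∀ j, IsMarkovKernel (κ j)]
    {H : ℝ → ℝ} (hH : Measurable H)
    (hval_eq : ∀ᵐ z ∂π.fst, hval (πcond z) = ENNReal.ofReal (H z) ∧ 0 ≤ H z)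
    (hmin : ∀ᵐ z ∂π.fst, KL (piKernel κ z) (πcond z) = hval (πcond z))
    (huniq : ∀ᵐ z ∂π.fst, ∀ ν, IsProductProb ν → KL ν (πcond z) = hval (πcond z) →
      ν = piKernel κ z) :
    (∀ μ, IsStar μ → KL (starMeasure (π.fst.tilted fun z => -H z) κ) π ≤ KL μ π) ∧
      ∀ μ, IsStar μ → KL μ π ≤ KL (starMeasure (π.fst.tilted fun z => -H z) κ) π →
        μ = starMeasure (π.fst.tilted fun z => -H z) κ := by
  set p := π.fst.tilted fun z => -H z with hp
  have hexp : Integrable (fun z => Real.exp (-H z)) π.fst :=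
    integrable_exp_neg_of_nonneg hH (hval_eq.mono fun _ h => h.2)
  have hpprob : IsProbabilityMeasure p := isProbabilityMeasure_tilted hexp
  have hpπ : p ≪ π.fst := tilted_absolutelyContinuous _ _
  obtain ⟨hfin, hgibbs⟩ := klDiv_add_lintegral_eq hH (hval_eq.mono fun _ h => h.2)
  rw [← hp] at hfin hgibbs
  set E : Measure ℝ → ℝ≥0∞ := fun μ => klDiv μ π.fst + ∫⁻ z, ENNReal.ofReal (H z) ∂μ with hE
  change E p ≠ ⊤ at hfin
  have hgibbs' : ∀ μ : Measure ℝ, IsProbabilityMeasure μ → E μ ≠ ⊤ → E μ = E p + klDiv μ p := hgibbs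
  have hpkl : ∀ᵐ z ∂π.fst, klDiv (piKernel κ z) (πcond z) = ENNReal.ofReal (H z) := by
    filter_upwards [hval_eq, hmin] with z h1 h2
    rw [← KL_eq_klDiv, h2, h1.1]
  have hpE : KL (starMeasure p κ) π = E p := by
    rw [(KL_starMeasure hdis ?_).2, lintegral_congr_ae (hpπ.ae_le hpkl)]
    filter_upwards [hpπ.ae_le hpkl] with z hz
    exact (klDiv_ne_top_iff.1 (by rw [hz]; exact ENNReal.ofReal_ne_top)).1
  have hle : ∀ (μ : Measure ℝ) (κ' : Fin k → Kernel ℝ ℝ), IsProbabilityMeasure μ →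
      ∀ _ : ∀ j, IsMarkovKernel (κ' j), KL (starMeasure μ κ') π ≠ ⊤ → μ ≪ π.fst ∧
        (∀ᵐ z ∂μ, ENNReal.ofReal (H z) ≤ klDiv (piKernel κ' z) (πcond z)) ∧
        AEMeasurable (fun z => klDiv (piKernel κ' z) (πcond z)) μ ∧
        KL (starMeasure μ κ') π =
          klDiv μ π.fst + ∫⁻ z, klDiv (piKernel κ' z) (πcond z) ∂μ := fun μ κ' _ _ h => by
    have hac : μ ⊗ₘ piKernel κ' ≪ π.fst ⊗ₘ πcond := by
      rw [starMeasure_eq_compProd, KL_eq_klDiv] at h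
      rw [← hdis]
      exact (klDiv_ne_top_iff.1 h).1
    obtain ⟨h1, h2⟩ := Measure.absolutelyContinuous_compProd_iff'.1 hac
    refine ⟨h1, ?_, KL_starMeasure hdis h2⟩
    filter_upwards [h1.ae_le hval_eq] with z hz
    rw [← hz.1, ← KL_eq_klDiv]
    exact iInf₂_le _ ⟨fun j => κ' j z, fun j => inferInstance, rfl⟩
  refine ⟨fun μ hμ => ?_, fun μ hμ hμle => ?_⟩
  · obtain ⟨-, μ₁, κ', h1, h2, rfl⟩ := hμ
    by_cases htop : KL (starMeasure μ₁ κ') π = ⊤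
    · simp [htop]
    obtain ⟨-, h4, -, h5⟩ := hle μ₁ κ' h1 h2 htop
    have h6 : E μ₁ ≤ KL (starMeasure μ₁ κ') π := by
      rw [h5]
      exact add_le_add_right (lintegral_mono_ae h4) _
    rw [hpE]
    refine le_trans ?_ h6
    rw [hgibbs' μ₁ h1 (ne_top_of_le_ne_top htop h6)]
    exact le_self_add
  · obtain ⟨-, μ₁, κ', h1, h2, rfl⟩ := hμ
    rw [hpE] at hμle
    obtain ⟨h3, h4, h4m, h5⟩ := hle μ₁ κ' h1 h2 (ne_top_of_le_ne_top hfin hμle)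
    have h6 : E μ₁ ≤ KL (starMeasure μ₁ κ') π := by
      rw [h5]
      exact add_le_add_right (lintegral_mono_ae h4) _
    have h7 : μ₁ = p := by
      have h := h6.trans hμle
      rw [hgibbs' μ₁ h1 (ne_top_of_le_ne_top hfin h)] at h
      refine klDiv_eq_zero_iff.1 (nonpos_iff_eq_zero.1 ?_)
      exact (ENNReal.add_le_add_iff_left hfin).1 (by rwa [add_zero])
    subst h7
    rw [h5] at hμle
    obtain ⟨hf1, hf2⟩ := ENNReal.add_ne_top.1 hfin
    have h8 := ae_eq_of_ae_le_of_lintegral_le h4 hf2 h4m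
      ((ENNReal.add_le_add_iff_left hf1).1 hμle)
    rw [starMeasure_eq_compProd, starMeasure_eq_compProd]
    refine Measure.compProd_congr ?_
    filter_upwards [h8, h3.ae_le hval_eq, h3.ae_le huniq] with z h9 h10 h11
    refine h11 _ ⟨fun j => κ' j z, fun j => inferInstance, rfl⟩ ?_
    rw [KL_eq_klDiv, ← h9, h10.1]

end

/-- **Existence, uniqueness, and form of the SSVI minimizer** (d = k+1 ≥ 2): under strong
log-concavity of `π ∝ exp(-V)` and the growth condition, the star-structured variational
problem has a unique minimizer `π⋆ = p⋆ ⊗ q⋆` with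
`p⋆ ∝ exp (-h_val) π₁` and, for `π₁`-a.e. `z₁`, `q⋆(· ∣ z₁)` the unique product-measure
minimizer attaining `h_val z₁`. -/
theorem stmt1 {k : ℕ} (hk : 1 ≤ k)
    (V : ℝ × (Fin k → ℝ) → ℝ) (α : ℝ) (hα : 0 < α)
    (hV : ContDiff ℝ 2 V) (hconv : StrongConvexWith α V) (hgr : GrowthCond V)
    (π : Measure (ℝ × (Fin k → ℝ))) [IsProbabilityMeasure π] (hπ : π = gibbs V)
    (πcond : Kernel ℝ (Fin k → ℝ)) [IsMarkovKernel πcond]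
    (hdis : π = π.fst ⊗ₘ πcond) :
    ∃ (p : Measure ℝ) (κ : Fin k → Kernel ℝ ℝ),
      IsProbabilityMeasure p ∧ (∀ j, IsMarkovKernel (κ j)) ∧
      IsStar (starMeasure p κ) ∧
      (∀ μ, IsStar μ → KL (starMeasure p κ) π ≤ KL μ π) ∧
      (∀ μ, IsStar μ → (∀ ν, IsStar ν → KL μ π ≤ KL ν π) → μ = starMeasure p κ) ∧
      (∃ c : ℝ, 0 < c ∧
        p = π.fst.withDensity fun z₁ =>
          ENNReal.ofReal (c * Real.exp (-(hval (πcond z₁)).toReal))) ∧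
      (∀ᵐ z₁ ∂π.fst,
        IsProductProb (Measure.pi fun j => κ j z₁) ∧
        KL (Measure.pi fun j => κ j z₁) (πcond z₁) = hval (πcond z₁) ∧
        ∀ ν, IsProductProb ν → KL ν (πcond z₁) = hval (πcond z₁) →
          ν = Measure.pi fun j => κ j z₁) := by
  obtain ⟨κ, H, hκ, hH, h⟩ := exists_kernel_attains_hval hα hV.continuous
    (strongMidConvex_of_strongConvexWith hconv)
  have hcond := cond_gibbs_ae_eq hV.continuous hπ hdis
  have hall : ∀ᵐ z ∂π.fst, hval (πcond z) = ENNReal.ofReal (H z) ∧ 0 ≤ H z ∧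
      KL (piKernel κ z) (πcond z) = hval (πcond z) ∧
      ∀ ν, IsProductProb ν → KL ν (πcond z) = hval (πcond z) → ν = piKernel κ z := by
    filter_upwards [hcond] with z hz
    rw [hz.2]
    exact h z hz.1
  have hval_eq : ∀ᵐ z ∂π.fst, hval (πcond z) = ENNReal.ofReal (H z) ∧ 0 ≤ H z :=
    hall.mono fun z hz => ⟨hz.1, hz.2.1⟩
  have hexp : Integrable (fun z => Real.exp (-H z)) π.fst :=
    integrable_exp_neg_of_nonneg hH (hval_eq.mono fun _ h => h.2)
  have hp := isProbabilityMeasure_tilted hexp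
  obtain ⟨h1, h2⟩ := starMeasure_tilted_minimizes hdis hH hval_eq
    (hall.mono fun z hz => hz.2.2.1) (hall.mono fun z hz => hz.2.2.2)
  refine ⟨π.fst.tilted fun z => -H z, κ, hp, hκ, isStar_starMeasure _ κ, h1,
    fun μ hμ hle => h2 μ hμ (hle _ (isStar_starMeasure _ κ)),
    ⟨_, inv_pos.2 (integral_exp_pos hexp), tilted_neg_hval_eq hval_eq⟩, ?_⟩
  filter_upwards [hall] with z hz
  exact ⟨⟨fun j => κ j z, fun j => inferInstance, rfl⟩, hz.2.2⟩
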